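/- Let p(n) be the number of positroids on [n] and p_c(n) the number of connected positroids on [n]. Then lim_{n→∞} p_c(n)/p(n) = 1/e². -/

import Mathlib

open Finset

/-- A full-row-rank real `d × n` matrix is *totally nonnegative* if all of its
maximal (`d × d`) minors are nonnegative.  Columns are indexed by a finite
linearly ordered set `E`; a maximal minor is indexed by a strictly increasing
choice of `d` columns. -/
def Matrix.TotallyNonneg {d : ℕ} {E : Type*} [Fintype E] [LinearOrder E]
    (A : Matrix (Fin d) E ℝ) : Prop :=
  A.rank = d ∧ ∀ f : Fin d → E, StrictMono f → 0 ≤ (A.submatrix id f).det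

/-- `ℬ` is the collection of bases of the column matroid `M(A)`: the `d`-element
sets of column indices whose columns are linearly independent. -/
def Matrix.RepresentsBases {d : ℕ} {E : Type*} [Fintype E]
    (A : Matrix (Fin d) E ℝ) (ℬ : Finset E → Prop) : Prop :=
  ∀ B : Finset E, ℬ B ↔ B.card = d ∧ LinearIndependent ℝ (fun j : B => fun i => A i j.1)

/-- A positroid of rank `d` on the finite linearly ordered ground set `E`,
given by its collection of bases `ℬ`. -/
def IsPositroidOfRank (d : ℕ) {E : Type*} [Fintype E] [LinearOrder E]
    (ℬ : Finset E → Prop) : Prop :=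
  ∃ A : Matrix (Fin d) E ℝ, A.TotallyNonneg ∧ A.RepresentsBases ℬ

/-- A positroid on the finite linearly ordered ground set `E`. -/
def IsPositroid {E : Type*} [Fintype E] [LinearOrder E] (ℬ : Finset E → Prop) : Prop :=
  ∃ d, IsPositroidOfRank d ℬ


/-- The basis-exchange axiom: `ℬ` is the (nonempty) collection of bases of a
matroid on the ground set `E`. -/
def IsBasesSet {E : Type*} [DecidableEq E] (ℬ : Finset E → Prop) : Prop :=
  (∃ B, ℬ B) ∧
  ∀ ⦃B₁ B₂ : Finset E⦄, ℬ B₁ → ℬ B₂ → ∀ b₁ ∈ B₁ \ B₂,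
    ∃ b₂ ∈ B₂ \ B₁, ℬ (insert b₂ (B₁.erase b₁))

/-- Lexicographic order on two `d`-element subsets of `Fin n` (with respect to
the standard order): comparing the increasing enumerations `s_1 < ... < s_d`
and `t_1 < ... < t_d`, either they agree or they first differ at an index `k`
where `s_k < t_k`. -/
def LexLE {n : ℕ} (d : ℕ) (S T : Finset (Fin n)) : Prop :=
  ∃ (hS : S.card = d) (hT : T.card = d),
    S = T ∨ ∃ k : Fin d,
      (∀ l, l < k → ((S.orderIsoOfFin hS) l : Fin n) = ((T.orderIsoOfFin hT) l : Fin n)) ∧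
      ((S.orderIsoOfFin hS) k : Fin n) < ((T.orderIsoOfFin hT) k : Fin n)

/-- Gale order on two `d`-element subsets of `Fin n` (with respect to the
standard order): the increasing enumerations satisfy `s_k ≤ t_k` for all `k`. -/
def GaleLE {n : ℕ} (d : ℕ) (S T : Finset (Fin n)) : Prop :=
  ∃ (hS : S.card = d) (hT : T.card = d),
    ∀ k : Fin d, ((S.orderIsoOfFin hS) k : Fin n) ≤ ((T.orderIsoOfFin hT) k : Fin n)

/-- Transfer of a basis collection supported on a subset `S ⊆ Fin n` to a basis
collection on the ground set `S` itself (a subtype carrying the inherited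
order). -/
def toSubtypePred {n : ℕ} (S : Finset (Fin n)) (ℬ : Finset (Fin n) → Prop) :
    Finset {x : Fin n // x ∈ S} → Prop :=
  fun C => ℬ (C.map (Function.Embedding.subtype fun x => x ∈ S))

/-- A matroid (given by its basis collection `ℬ` on the ground set `E`) is
*connected* if it cannot be written as the direct sum of two matroids on
nonempty ground sets. -/
def MatroidConnected {E : Type*} [Fintype E] [DecidableEq E] (ℬ : Finset E → Prop) : Prop :=
  ¬ ∃ (E₁ E₂ : Finset E) (ℬ₁ ℬ₂ : Finset E → Prop),
      E₁.Nonempty ∧ E₂.Nonempty ∧ Disjoint E₁ E₂ ∧ E₁ ∪ E₂ = Finset.univ ∧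
      IsBasesSet ℬ₁ ∧ IsBasesSet ℬ₂ ∧
      (∀ B, ℬ₁ B → B ⊆ E₁) ∧ (∀ B, ℬ₂ B → B ⊆ E₂) ∧
      (∀ B, ℬ B ↔ ∃ B₁ B₂, ℬ₁ B₁ ∧ ℬ₂ B₂ ∧ B = B₁ ∪ B₂)

/-- `a, b, c, d` are (distinct and) in cyclic order in `Fin m`. -/
def Cyc4 {m : ℕ} (a b c d : Fin m) : Prop :=
  0 < (b - a).val ∧ (b - a).val < (c - a).val ∧ (c - a).val < (d - a).val

/-- The number of positroids on `[n]`, each positroid identified with its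
(finite) collection of bases. -/
noncomputable def numPositroids (n : ℕ) : ℕ :=
  Nat.card {ℬ : Finset (Finset (Fin n)) // IsPositroid (fun B => B ∈ ℬ)}

/-- The number of connected positroids on `[n]`, each positroid identified with
its (finite) collection of bases. -/
noncomputable def numConnPositroids (n : ℕ) : ℕ :=
  Nat.card {ℬ : Finset (Finset (Fin n)) //
    IsPositroid (fun B => B ∈ ℬ) ∧ MatroidConnected (fun B => B ∈ ℬ)}


open Finset

namespace Posi
open Submodule Module

/-- span of the vectors indexed by `S`. -/
noncomputable def sp {V : Type*} [AddCommGroup V] [Module ℝ V] {E : Type*} (v : E → V) (S : Finset E) :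
    Submodule ℝ V := span ℝ (v '' (S : Set E))

/-- rank of the vectors indexed by `S`. -/
noncomputable def rk {V : Type*} [AddCommGroup V] [Module ℝ V] {E : Type*} (v : E → V) (S : Finset E) : ℕ :=
  finrank ℝ (sp v S)

set_option linter.unusedSectionVars false
section LA
variable {V : Type*} [AddCommGroup V] [Module ℝ V] {E : Type*} [DecidableEq E] (v : E → V)

instance sp_fd (S : Finset E) : FiniteDimensional ℝ (sp v S) :=
  FiniteDimensional.span_of_finite ℝ (S.finite_toSet.image v)

theorem li_iff (S : Finset E) : LinearIndepOn ℝ v (S : Set E) ↔ rk v S = S.card := by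
  unfold LinearIndepOn
  rw [linearIndependent_iff_card_eq_finrank_span]
  unfold rk sp Set.finrank
  rw [Set.image_eq_range]
  simp [eq_comm]

theorem sp_mono {S T : Finset E} (h : S ⊆ T) : sp v S ≤ sp v T :=
  span_mono (Set.image_mono (by exact_mod_cast h))

theorem mem_sp {S : Finset E} {x : E} (h : x ∈ S) : v x ∈ sp v S :=
  subset_span (Set.mem_image_of_mem v (by exact_mod_cast h))

theorem sp_le {S : Finset E} {W : Submodule ℝ V} (h : ∀ x ∈ S, v x ∈ W) : sp v S ≤ W := by
  unfold sp
  rw [span_le]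
  rintro _ ⟨x, hx, rfl⟩
  exact h x (by exact_mod_cast hx)

theorem sp_union (S T : Finset E) : sp v (S ∪ T) = sp v S ⊔ sp v T := by
  unfold sp
  rw [Finset.coe_union, Set.image_union, span_union]

theorem sp_insert (a : E) (S : Finset E) : sp v (insert a S) = span ℝ {v a} ⊔ sp v S := by
  rw [Finset.insert_eq, sp_union]
  congr 1
  simp [sp]

theorem rk_mono {S T : Finset E} (h : S ⊆ T) : rk v S ≤ rk v T :=
  Submodule.finrank_mono (sp_mono v h)

theorem rk_le_of_sp_le {S T : Finset E} (h : sp v S ≤ sp v T) : rk v S ≤ rk v T :=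
  Submodule.finrank_mono h

theorem rk_le_card (S : Finset E) : rk v S ≤ S.card := by
  classical
  unfold rk sp
  have := finrank_span_finset_le_card (R := ℝ) (S.image v)
  rw [Finset.coe_image] at this
  exact this.trans Finset.card_image_le

theorem li_insert {S : Finset E} {a : E} (ha : a ∉ S) :
    LinearIndepOn ℝ v ((insert a S : Finset E) : Set E) ↔
      LinearIndepOn ℝ v (S : Set E) ∧ v a ∉ sp v S := by
  rw [Finset.coe_insert, linearIndepOn_insert (by exact_mod_cast ha)]
  rfl

theorem rk_insert_of_mem {S : Finset E} {a : E} (ha : v a ∈ sp v S) :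
    rk v (insert a S) = rk v S := by
  unfold rk
  rw [sp_insert, sup_eq_right.2]
  simpa using ha

theorem rk_insert_of_notMem {S : Finset E} {a : E} (ha : v a ∉ sp v S) :
    rk v (insert a S) = rk v S + 1 := by
  unfold rk
  rw [sp_insert, sup_comm]
  have h := Submodule.finrank_sup_add_finrank_inf_eq (sp v S) (span ℝ {v a})
  have h0 : v a ≠ 0 := by
    intro h; rw [h] at ha; exact ha (zero_mem _)
  rw [finrank_span_singleton h0] at h
  have h1 : sp v S ⊓ span ℝ {v a} = ⊥ := by
    rw [← disjoint_iff]
    exact (Submodule.disjoint_span_singleton' h0).2 ha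
  rw [h1, finrank_bot] at h
  omega

/-- extension of independent sets -/
theorem exists_ext {S T : Finset E} (hS : LinearIndepOn ℝ v (S : Set E)) (hST : S ⊆ T) :
    ∃ B : Finset E, S ⊆ B ∧ B ⊆ T ∧ LinearIndepOn ℝ v (B : Set E) ∧ sp v B = sp v T := by
  classical
  obtain ⟨b, hb, hsb, hsp, hli⟩ := exists_linearIndepOn_extension hS (Finset.coe_subset.2 hST)
  have hfin : b.Finite := T.finite_toSet.subset hb
  refine ⟨hfin.toFinset, ?_, ?_, ?_, ?_⟩
  · intro x hx
    simpa using hsb (by exact_mod_cast hx)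
  · intro x hx
    have := hb (by simpa using hx)
    exact_mod_cast this
  · simpa using hli
  · apply le_antisymm
    · apply sp_mono
      intro x hx
      have := hb (by simpa using hx)
      exact_mod_cast this
    · unfold sp
      rw [span_le]
      simpa using hsp

theorem exists_basis (T : Finset E) :
    ∃ B : Finset E, B ⊆ T ∧ LinearIndepOn ℝ v (B : Set E) ∧ sp v B = sp v T := by
  obtain ⟨B, -, h⟩ := exists_ext v (S := ∅) (T := T) (by simp) (by simp)
  exact ⟨B, h⟩

/-- some element of `S` outside `S₀` is used for `x`. -/
theorem exists_used {S S₀ : Finset E} (hS : LinearIndepOn ℝ v (S : Set E)) {x : V}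
    (hx : x ∈ sp v S) (hx0 : x ∉ sp v S₀) : ∃ y ∈ S, y ∉ S₀ ∧ x ∉ sp v (S.erase y) := by
  by_contra hcon
  push Not at hcon
  have hx' := hx
  unfold sp at hx'
  rw [mem_span_image_finset_iff_exists_fun] at hx'
  obtain ⟨c, hc⟩ := hx'
  apply hx0
  rw [← hc]
  refine sum_mem ?_
  rintro ⟨i, hi⟩ -
  by_cases hi0 : i ∈ S₀
  · exact smul_mem _ _ (mem_sp v hi0)
  by_cases hci : c ⟨i, hi⟩ = 0
  · simp [hci]
  exfalso
  have h1 := hcon i hi hi0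
  have h2 : v i ∉ sp v (S.erase i) := by
    have := (li_insert v (S := S.erase i) (a := i) (by simp)).1 (by rwa [Finset.insert_erase hi])
    exact this.2
  apply h2
  have h3 : c ⟨i, hi⟩ • v i ∈ sp v (S.erase i) := by
    have : c ⟨i, hi⟩ • v i = x - ∑ j ∈ Finset.univ.erase ⟨i, hi⟩, c j • v j := by
      rw [← hc, ← Finset.add_sum_erase _ _ (Finset.mem_univ (⟨i, hi⟩ : {x // x ∈ S}))]
      abel
    rw [this]
    refine sub_mem h1 (sum_mem ?_)
    rintro ⟨j, hj⟩ hj'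
    refine smul_mem _ _ (mem_sp v ?_)
    simp at hj'
    simp [hj', hj]
  exact (smul_mem_iff _ hci).1 h3

/-- If `F ∪ X`, `F ∪ Y` is not a modular pair, there is an exchange pair between `X` and `Y`
in the contraction by `F`. -/
theorem exists_exch {F X Y : Finset E} (hFX : Disjoint F X) (hFY : Disjoint F Y)
    (hXY : Disjoint X Y)
    (hlt : rk v (F ∪ X ∪ Y) + rk v F < rk v (F ∪ X) + rk v (F ∪ Y)) :
    ∃ R ⊆ F ∪ X ∪ Y, LinearIndepOn ℝ v (R : Set E) ∧ sp v R = sp v (F ∪ X ∪ Y) ∧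
      (R ∩ F).card = rk v F ∧ ∃ y ∈ R, y ∈ Y ∧ ∃ x ∈ X, x ∉ R ∧
        LinearIndepOn ℝ v ((insert x (R.erase y) : Finset E) : Set E) := by
  obtain ⟨S, hSF, hS, hSsp⟩ := exists_basis v F
  obtain ⟨T, hST, hTFY, hT, hTsp⟩ := exists_ext v hS (hSF.trans (Finset.subset_union_left (s₂ := Y)))
  obtain ⟨R, hTR, hRA, hR, hRsp⟩ := exists_ext v hT
    (show T ⊆ F ∪ X ∪ Y from hTFY.trans (by intro x; simp; tauto))
  have hSR := hST.trans hTR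
  have cS : S.card = rk v F := by rw [← (li_iff v S).1 hS]; unfold rk; rw [hSsp]
  have cT : T.card = rk v (F ∪ Y) := by rw [← (li_iff v T).1 hT]; unfold rk; rw [hTsp]
  have cR : R.card = rk v (F ∪ X ∪ Y) := by rw [← (li_iff v R).1 hR]; unfold rk; rw [hRsp]
  have cRF : (R ∩ F).card = rk v F := by
    apply le_antisymm
    · rw [← (li_iff v (R ∩ F)).1 (hR.mono (by simp))]
      exact rk_mono v Finset.inter_subset_right
    · rw [← cS]
      exact Finset.card_le_card (Finset.subset_inter hSR hSF)
  have hSF' : S = R ∩ F :=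
    Finset.eq_of_subset_of_card_le (Finset.subset_inter hSR hSF) (by omega)
  have hcard : R.card = (R ∩ F).card + (R ∩ X).card + (R ∩ Y).card := by
    rw [← Finset.card_union_of_disjoint, ← Finset.card_union_of_disjoint]
    · congr 1
      ext x
      have := @hRA x
      simp at this ⊢
      tauto
    · rw [Finset.disjoint_left] at *
      intro a ha hb
      simp at ha hb
      rcases ha with ha | ha
      · exact hFY ha.2 hb.2
      · exact hXY ha.2 hb.2
    · exact hFX.mono Finset.inter_subset_right Finset.inter_subset_right
  have hTY : T.card ≤ (R ∩ F).card + (R ∩ Y).card := by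
    refine le_trans (Finset.card_le_card ?_) (Finset.card_union_le _ _)
    intro x hx
    have h1 := hTFY hx
    have h2 := hTR hx
    simp at h1 ⊢
    tauto
  have hex : ∃ x ∈ X, v x ∉ sp v (R ∩ F ∪ R ∩ X) := by
    by_contra hcon
    push Not at hcon
    have h1 : sp v (F ∪ X) ≤ sp v (R ∩ F ∪ R ∩ X) := by
      rw [sp_union, ← hSsp, hSF']
      refine sup_le (sp_mono v Finset.subset_union_left) (sp_le v hcon)
    have h2 := rk_le_of_sp_le v h1
    have h3 := (rk_le_card v (R ∩ F ∪ R ∩ X)).trans (Finset.card_union_le _ _)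
    omega
  obtain ⟨x, hxX, hx⟩ := hex
  have hxR : x ∉ R := fun h => hx (mem_sp v (by simp [h, hxX]))
  have hxsp : v x ∈ sp v R := by
    rw [hRsp]; exact mem_sp v (by simp [hxX])
  obtain ⟨y, hyR, hy, hxy⟩ := exists_used v hR hxsp hx
  refine ⟨R, hRA, hR, hRsp, cRF, y, hyR, ?_, x, hxX, hxR, ?_⟩
  · have := hRA hyR
    simp at this hy
    tauto
  · rw [li_insert v (by simp [hxR])]
    exact ⟨hR.mono (by simp), hxy⟩

/-- replace basis of `F` in an independent set. -/
theorem li_replace {S S' T : Finset E} (h : LinearIndepOn ℝ v ((S ∪ T : Finset E) : Set E))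
    (hd : Disjoint S T) (hsp : sp v S = sp v S') (hc : S.card = S'.card) :
    LinearIndepOn ℝ v ((S' ∪ T : Finset E) : Set E) := by
  rw [li_iff] at h ⊢
  have h1 : rk v (S' ∪ T) = rk v (S ∪ T) := by
    unfold rk; rw [sp_union, sp_union, hsp]
  have h2 := rk_le_card v (S' ∪ T)
  have h3 := Finset.card_union_le S' T
  rw [Finset.card_union_of_disjoint hd] at h
  omega

end LA
end Posi

open Finset

namespace Posi
open Submodule Module

/-- The columns of a matrix. -/
def cv {d n : ℕ} (A : Matrix (Fin d) (Fin n) ℝ) : Fin n → (Fin d → ℝ) := fun j i => A i j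

/-- functional: determinant with first column free, others the sorted columns of `W`. -/
noncomputable def phi {m n : ℕ} (v : Fin n → (Fin (m + 1) → ℝ)) (W : Finset (Fin n)) (hW : W.card = m)
    (x : Fin (m + 1) → ℝ) : ℝ :=
  Matrix.detRowAlternating.curryLeft x (fun l => v (W.orderEmbOfFin hW l))

theorem phi_zero_of_mem {m n : ℕ} (v : Fin n → (Fin (m + 1) → ℝ)) (W : Finset (Fin n))
    (hW : W.card = m) {x : Fin (m + 1) → ℝ} (hx : x ∈ sp v W) : phi v W hW x = 0 := by
  let L : (Fin (m + 1) → ℝ) →ₗ[ℝ] ℝ :=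
    { toFun := phi v W hW
      map_add' := by intro a b; simp [phi]
      map_smul' := by intro a b; simp [phi] }
  have : sp v W ≤ LinearMap.ker L := by
    apply sp_le
    intro a ha
    rw [LinearMap.mem_ker]
    change phi v W hW (v a) = 0
    unfold phi
    rw [AlternatingMap.curryLeft_apply_apply]
    obtain ⟨l, hl⟩ : a ∈ Set.range (W.orderEmbOfFin hW) := by
      rw [Finset.range_orderEmbOfFin]; exact ha
    refine AlternatingMap.map_eq_zero_of_eq _ _ (i := 0) (j := l.succ) ?_ ?_
    · simp [hl]
    · exact (Fin.succ_ne_zero l).symm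
  exact LinearMap.mem_ker.1 (this hx)

theorem phi_ne_zero {m n : ℕ} (v : Fin n → (Fin (m + 1) → ℝ)) (W : Finset (Fin n))
    (hW : W.card = m) {a : Fin n} (ha : a ∉ W)
    (h : LinearIndepOn ℝ v ((insert a W : Finset _) : Set (Fin n))) : phi v W hW (v a) ≠ 0 := by
  unfold phi
  rw [AlternatingMap.curryLeft_apply_apply]
  set M : Matrix (Fin (m + 1)) (Fin (m + 1)) ℝ :=
    Matrix.vecCons (v a) (fun l => v (W.orderEmbOfFin hW l)) with hM
  change M.det ≠ 0
  have hli : LinearIndependent ℝ M.row := by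
    let e : Fin (m + 1) → ((insert a W : Finset _) : Set (Fin n)) :=
      Fin.cons ⟨a, by simp⟩ (fun l => ⟨W.orderEmbOfFin hW l, by simp⟩)
    have he : Function.Injective e := by
      intro i j
      refine Fin.cases ?_ (fun i => ?_) i <;> refine Fin.cases ?_ (fun j => ?_) j
      · simp
      · intro h
        exfalso
        simp [e] at h
        apply ha; rw [h]; simp
      · intro h
        exfalso
        simp [e] at h
        apply ha; rw [← h]; simp
      · simp [e]
    have h2 := h.linearIndependent.comp e he
    convert h2 using 1
    funext i
    refine Fin.cases ?_ (fun i => ?_) i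
    · simp [e, M, Matrix.row]
    · simp [e, M, Matrix.row]
  rw [Matrix.linearIndependent_rows_iff_isUnit] at hli
  exact ((Matrix.isUnit_iff_isUnit_det _).1 hli).ne_zero

theorem phi_nonneg {m n : ℕ} {A : Matrix (Fin (m + 1)) (Fin n) ℝ} (hA : A.TotallyNonneg)
    (W : Finset (Fin n)) (hW : W.card = m) {a : Fin n} (ha : a ∉ W) :
    0 ≤ (-1) ^ (W.filter (· < a)).card * phi (cv A) W hW (cv A a) := by
  set g := W.orderEmbOfFin hW with hg
  have hp : (W.filter (· < a)).card < m + 1 := by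
    have := Finset.card_filter_le W (· < a)
    omega
  set p : Fin (m + 1) := ⟨(W.filter (· < a)).card, hp⟩ with hpdef
  have hga : ∀ l, g l ≠ a := fun l h => ha (by rw [← h]; simp [g])
  have hlt : ∀ l : Fin m, g l < a ↔ (l : ℕ) < p := by
    intro l
    have hcard : ∀ l : Fin m, (W.filter (· < g l)).card = l := by
      intro l
      have : W.filter (· < g l) = (Finset.univ.filter (· < l)).map g.toEmbedding := by
        ext x
        simp only [Finset.mem_filter, Finset.mem_map, Finset.mem_univ, true_and]
        constructor
        · rintro ⟨hx, hxl⟩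
          obtain ⟨k, hk⟩ : x ∈ Set.range g := by
            rw [Finset.range_orderEmbOfFin]; exact hx
          refine ⟨k, ?_, hk⟩
          rw [← hk] at hxl
          exact g.lt_iff_lt.1 hxl
        · rintro ⟨k, hk, rfl⟩
          exact ⟨by simp [g], g.lt_iff_lt.2 hk⟩
      rw [this, Finset.card_map]
      rw [show Finset.univ.filter (· < l) = Finset.Iio l by ext; simp, Fin.card_Iio]
    constructor
    · intro h
      change (l : ℕ) < (W.filter (· < a)).card
      rw [← hcard l]
      apply Finset.card_lt_card
      rw [Finset.ssubset_iff_of_subset]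
      · exact ⟨g l, by simp [h, g], by simp⟩
      · intro x hx
        simp at hx ⊢
        exact ⟨hx.1, hx.2.trans h⟩
    · intro h
      by_contra hcon
      have h1 : a < g l := lt_of_le_of_ne (not_lt.1 hcon) (hga l).symm
      have h2 : (W.filter (· < a)).card ≤ (W.filter (· < g l)).card := by
        apply Finset.card_le_card
        intro x hx
        simp at hx ⊢
        exact ⟨hx.1, hx.2.trans h1⟩
      rw [hcard l] at h2
      change (l : ℕ) < (W.filter (· < a)).card at h
      omega
  have hmono : StrictMono (p.insertNth (α := fun _ => Fin n) a g) := by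
    rw [Fin.strictMono_insertNth_iff]
    refine ⟨g.strictMono, fun l hl => (hlt l).2 hl, fun l hl => ?_⟩
    refine lt_of_le_of_ne (not_lt.1 fun h => ?_) (hga l).symm
    exact absurd ((hlt l).1 h) (not_lt.2 hl)
  have h1 := hA.2 _ hmono
  have h2 : (A.submatrix id (p.insertNth (α := fun _ => Fin n) a g)).det =
      Matrix.detRowAlternating (p.insertNth (α := fun _ => (Fin (m + 1) → ℝ)) (cv A a) (fun l => cv A (g l))) := by
    rw [← Matrix.det_transpose]
    change Matrix.det _ = Matrix.det _
    congr 1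
    ext i j
    refine Fin.succAboveCases p ?_ (fun l => ?_) i
    · simp [cv]
    · simp [cv]
  rw [h2, AlternatingMap.map_insertNth] at h1
  unfold phi
  rw [AlternatingMap.curryLeft_apply_apply]
  simpa using h1


theorem cnt_insert {n : ℕ} (U : Finset (Fin n)) {y a : Fin n} (hy : y ∉ U) :
    ((insert y U).filter (· < a)).card = (U.filter (· < a)).card + if y < a then 1 else 0 := by
  rw [Finset.filter_insert]
  split_ifs with h
  · rw [Finset.card_insert_of_notMem (by simp [hy])]
  · rfl

/-- Two crossing exchange pairs. -/
theorem cross {d n : ℕ} {A : Matrix (Fin d) (Fin n) ℝ} (hA : A.TotallyNonneg)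
    {U : Finset (Fin n)} {p q y z : Fin n} (hU : U.card + 2 = d) (hpy : p < y) (hyq : y < q)
    (hz : z < p ∨ q < z) (hpU : p ∉ U) (hqU : q ∉ U) (hyU : y ∉ U) (hzU : z ∉ U)
    (h1 : LinearIndepOn ℝ (cv A) ((insert p (insert y U) : Finset _) : Set (Fin n)))
    (h2 : LinearIndepOn ℝ (cv A) ((insert q (insert y U) : Finset _) : Set (Fin n)))
    (h3 : LinearIndepOn ℝ (cv A) ((insert p (insert z U) : Finset _) : Set (Fin n)))
    (h4 : LinearIndepOn ℝ (cv A) ((insert q (insert z U) : Finset _) : Set (Fin n))) :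
    LinearIndepOn ℝ (cv A) ((insert q (insert p U) : Finset _) : Set (Fin n)) := by
  subst hU
  by_contra hcon
  have hpq := hpy.trans hyq
  have hpz : p ≠ z := by rintro rfl; rcases hz with h | h <;> order
  have hqz : q ≠ z := by rintro rfl; rcases hz with h | h <;> order
  have hUp : LinearIndepOn ℝ (cv A) ((insert p U : Finset _) : Set (Fin n)) := h1.mono (by
    intro x; simp; tauto)
  rw [li_insert _ (by simp [hqU, hpq.ne'])] at hcon
  push Not at hcon
  have hq := hcon hUp
  rw [sp_insert, Submodule.mem_sup] at hq
  obtain ⟨y', hy', u, hu, hyu⟩ := hq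
  obtain ⟨c, rfl⟩ := Submodule.mem_span_singleton.1 hy'
  have hlin : ∀ (W : Finset (Fin n)) (hW : W.card = U.card + 1), U ⊆ W →
      phi (cv A) W hW (cv A q) = c * phi (cv A) W hW (cv A p) := by
    intro W hW hUW
    have h0 := phi_zero_of_mem (cv A) W hW (sp_mono _ hUW hu)
    rw [← hyu]
    unfold phi at *
    rw [map_add, map_smul, AlternatingMap.add_apply, h0, AlternatingMap.smul_apply]
    simp
  have cy : (insert y U).card = U.card + 1 := Finset.card_insert_of_notMem hyU
  have cz : (insert z U).card = U.card + 1 := Finset.card_insert_of_notMem hzU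
  have ny1 : p ∉ insert y U := by simp [hpU, hpy.ne]
  have ny2 : q ∉ insert y U := by simp [hqU, hyq.ne']
  have nz1 : p ∉ insert z U := by simp [hpU, hpz]
  have nz2 : q ∉ insert z U := by simp [hqU, hqz]
  have a1 := phi_nonneg hA _ cy ny1
  have a2 := phi_nonneg hA _ cy ny2
  have a3 := phi_nonneg hA _ cz nz1
  have a4 := phi_nonneg hA _ cz nz2
  have b1 := phi_ne_zero _ _ cy ny1 h1
  have b2 := phi_ne_zero _ _ cy ny2 h2
  have b3 := phi_ne_zero _ _ cz nz1 h3
  rw [hlin _ cy (by simp)] at a2 b2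
  rw [hlin _ cz (by simp)] at a4
  rw [cnt_insert _ hyU] at a1 a2
  rw [cnt_insert _ hzU] at a3 a4
  have hc : c ≠ 0 := by rintro rfl; simp at b2
  rw [if_neg (not_lt.2 hpy.le)] at a1
  rw [if_pos hyq] at a2
  have hzz : (if z < p then 1 else 0 : ℕ) = if z < q then 1 else 0 := by
    rcases hz with h | h
    · rw [if_pos h, if_pos (h.trans hpq)]
    · rw [if_neg (by order), if_neg (by order)]
  rw [hzz] at a3
  set X := phi (cv A) _ cy (cv A p)
  set X' := phi (cv A) _ cz (cv A p)
  rw [pow_add] at a1 a2 a3 a4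
  set e1 : ℝ := (-1) ^ (U.filter (· < p)).card with he1
  set e2 : ℝ := (-1) ^ (U.filter (· < q)).card with he2
  set e3 : ℝ := (-1) ^ (if z < q then 1 else 0 : ℕ) with he3
  have f1 : e1 ≠ 0 := pow_ne_zero _ (by norm_num)
  have f2 : e2 ≠ 0 := pow_ne_zero _ (by norm_num)
  have f3 : e3 ≠ 0 := pow_ne_zero _ (by norm_num)
  have k1 : 0 ≤ -(e1 * e2 * c) := by
    refine nonneg_of_mul_nonneg_left (b := X ^ 2) ?_ (by positivity)
    have := mul_nonneg a1 a2
    simp only [pow_zero, pow_one] at this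
    linarith [this]
  have k2 : 0 ≤ e1 * e2 * c := by
    refine nonneg_of_mul_nonneg_left (b := (e3 * X') ^ 2) ?_ (by positivity)
    have := mul_nonneg a3 a4
    linarith [this]
  have k3 : e1 * e2 * c ≠ 0 := by positivity
  exact k3 (by linarith)

end Posi

open Finset

namespace Posi
open Submodule Module

/-- residue -/
def o (n : ℕ) [NeZero n] (k : ℕ) : Fin n := Fin.ofNat n k

theorem o_eq_iff {n : ℕ} [NeZero n] {a b : ℕ} : o n a = o n b ↔ a ≡ b [MOD n] := by
  unfold o Nat.ModEq
  rw [Fin.ext_iff]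
  simp

theorem o_val {n : ℕ} [NeZero n] (x : Fin n) : o n x.val = x := by
  unfold o; simp

theorem o_coe {n : ℕ} [NeZero n] (k : ℕ) : (o n k : ℕ) = k % n := by
  unfold o; simp

theorem o_add {n : ℕ} [NeZero n] (k : ℕ) : o n (k + n) = o n k := by
  rw [o_eq_iff]; simp [Nat.ModEq]

theorem o_succ {n : ℕ} [NeZero n] {a b : ℕ} : o n (a + 1) = o n (b + 1) ↔ o n a = o n b := by
  rw [o_eq_iff, o_eq_iff]
  exact ⟨fun h => Nat.ModEq.add_right_cancel' 1 h, fun h => Nat.ModEq.add_right 1 h⟩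

/-- cyclic window -/
def win (n : ℕ) [NeZero n] (s t : ℕ) : Finset (Fin n) := (Finset.Ico s t).image (o n)

theorem mem_win {n : ℕ} [NeZero n] {s t : ℕ} {x : Fin n} :
    x ∈ win n s t ↔ ∃ k, s ≤ k ∧ k < t ∧ o n k = x := by
  simp [win, and_assoc]

/-- no cyclic adjacency -/
def NA {n : ℕ} [NeZero n] (X Y : Finset (Fin n)) : Prop :=
  ∀ k, ¬(o n k ∈ X ∧ o n (k + 1) ∈ Y) ∧ ¬(o n k ∈ Y ∧ o n (k + 1) ∈ X)

/-- number of cyclic boundaries -/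
def bd {n : ℕ} [NeZero n] (X : Finset (Fin n)) : ℕ :=
  ((Finset.range n).filter (fun k => ¬(o n k ∈ X ↔ o n (k + 1) ∈ X))).card

theorem bd_compl {n : ℕ} [NeZero n] (X : Finset (Fin n)) : bd Xᶜ = bd X := by
  unfold bd
  congr 1
  ext k
  simp only [Finset.mem_filter, Finset.mem_compl]
  tauto

theorem exists_bd {n : ℕ} [NeZero n] {X : Finset (Fin n)} (h1 : X.Nonempty) (h2 : Xᶜ.Nonempty) :
    ∃ k, o n k ∈ X ∧ o n (k + 1) ∉ X := by
  by_contra hcon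
  push Not at hcon
  obtain ⟨x, hx⟩ := h1
  obtain ⟨y, hy⟩ := h2
  rw [Finset.mem_compl] at hy
  have : ∀ j, o n (x.val + j) ∈ X := by
    intro j
    induction j with
    | zero => rwa [add_zero, o_val]
    | succ j ih => exact hcon _ ih
  apply hy
  have h3 := this (n - x.val + y.val)
  have h4 : x.val + (n - x.val + y.val) = y.val + n := by have := x.2; omega
  rwa [h4, o_add, o_val] at h3

theorem bd_pos {n : ℕ} [NeZero n] {X : Finset (Fin n)} (h1 : X.Nonempty) (h2 : Xᶜ.Nonempty) :
    0 < bd X := by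
  obtain ⟨k, hk, hk'⟩ := exists_bd h1 h2
  apply Finset.card_pos.2
  refine ⟨k % n, ?_⟩
  have e1 : o n (k % n) = o n k := o_eq_iff.2 (Nat.mod_modEq k n)
  have e2 : o n (k % n + 1) = o n (k + 1) := o_succ.2 e1
  simp only [Finset.mem_filter, Finset.mem_range]
  rw [e1, e2]
  exact ⟨Nat.mod_lt _ (Nat.pos_of_ne_zero (NeZero.ne n)), by tauto⟩

theorem bd_split {n : ℕ} [NeZero n] {X Y : Finset (Fin n)} (hd : Disjoint X Y) (hna : NA X Y)
    (h1 : X.Nonempty) (h2 : Y.Nonempty) : bd X < bd (X ∪ Y) ∧ bd Y < bd (X ∪ Y) := by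
  have hX : Xᶜ.Nonempty := by
    obtain ⟨y, hy⟩ := h2
    exact ⟨y, Finset.mem_compl.2 (Finset.disjoint_right.1 hd hy)⟩
  have hY : Yᶜ.Nonempty := by
    obtain ⟨y, hy⟩ := h1
    exact ⟨y, Finset.mem_compl.2 (Finset.disjoint_left.1 hd hy)⟩
  have hs : bd (X ∪ Y) = bd X + bd Y := by
    unfold bd
    rw [← Finset.card_union_of_disjoint]
    · congr 1
      ext k
      simp only [Finset.mem_filter, Finset.mem_union]
      have a1 := hna k
      have a2 : o n k ∈ X → o n k ∉ Y := fun h => Finset.disjoint_left.1 hd h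
      have a3 : o n (k + 1) ∈ X → o n (k + 1) ∉ Y := fun h => Finset.disjoint_left.1 hd h
      tauto
    · rw [Finset.disjoint_left]
      intro k
      simp only [Finset.mem_filter]
      have a1 := hna k
      have a2 : o n k ∈ X → o n k ∉ Y := fun h => Finset.disjoint_left.1 hd h
      have a3 : o n (k + 1) ∈ X → o n (k + 1) ∉ Y := fun h => Finset.disjoint_left.1 hd h
      tauto
  have := bd_pos h1 hX
  have := bd_pos h2 hY
  omega

theorem walk {p q : ℕ → Prop} {x y : ℕ} (hxy : x ≤ y) (hp : p x) (hq : q y)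
    (h : ∀ k, x ≤ k → k ≤ y → p k ∨ q k) (hd : ∀ k, ¬(p k ∧ q k)) : ∃ k, p k ∧ q (k + 1) := by
  by_contra hcon
  push Not at hcon
  have : ∀ j, x + j ≤ y → p (x + j) := by
    intro j
    induction j with
    | zero => intro _; simpa using hp
    | succ j ih =>
      intro hj
      have h1 := ih (by omega)
      have h2 := hcon _ h1
      have h3 := h (x + (j + 1)) (by omega) hj
      exact h3.resolve_right h2
  have h1 := this (y - x) (by omega)
  rw [show x + (y - x) = y by omega] at h1
  exact hd y ⟨h1, hq⟩

theorem sides {n : ℕ} [NeZero n] {F X Y : Finset (Fin n)} (hc : F ∪ X ∪ Y = Finset.univ)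
    (hFX : Disjoint F X) (hFY : Disjoint F Y) (hd : Disjoint X Y) (hna : NA X Y) {x y : Fin n} (hx : x ∈ X) (hy : y ∈ Y)
    (hlt : x < y) : (∃ a ∈ F, x < a ∧ a < y) ∧ (∃ a ∈ F, a < x ∨ y < a) := by
  have hxF : ∀ z ∈ F, z ≠ x := fun z hz h => Finset.disjoint_left.1 hFX hz (h ▸ hx)
  have hyF : ∀ z ∈ F, z ≠ y := fun z hz h => Finset.disjoint_left.1 hFY hz (h ▸ hy)
  have hcov : ∀ z, z ∉ F → z ∈ X ∨ z ∈ Y := by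
    intro z hz
    have := Finset.mem_univ z
    rw [← hc] at this
    simp only [Finset.mem_union] at this
    tauto
  constructor
  · by_contra hcon
    push Not at hcon
    obtain ⟨k, hk1, hk2⟩ := walk (p := fun k => o n k ∈ X) (q := fun k => o n k ∈ Y)
      (x := x.val) (y := y.val) (le_of_lt hlt) (by rwa [o_val]) (by rwa [o_val])
      (by
        intro k h1 h2
        apply hcov
        intro hF
        have hv : ((o n k : Fin n) : ℕ) = k := by
          rw [o_coe, Nat.mod_eq_of_lt (by omega)]
        have n1 := hxF _ hF
        have n2 := hyF _ hF
        have h3 := hcon _ hF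
        rw [Fin.lt_def, Fin.le_def, hv] at h3
        rw [Ne, Fin.ext_iff, hv] at n1 n2
        omega)
      (fun k h => Finset.disjoint_left.1 hd h.1 h.2)
    exact (hna k).1 ⟨hk1, hk2⟩
  · by_contra hcon
    push Not at hcon
    obtain ⟨k, hk1, hk2⟩ := walk (p := fun k => o n k ∈ Y) (q := fun k => o n k ∈ X)
      (x := y.val) (y := x.val + n) (by omega) (by rwa [o_val]) (by rwa [o_add, o_val])
      (by
        intro k h1 h2
        apply Or.symm
        apply hcov
        intro hF
        have n1 := hxF _ hF
        have n2 := hyF _ hF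
        have h3 := hcon _ hF
        rw [Fin.le_def, Fin.le_def, o_coe] at h3
        rw [Ne, Fin.ext_iff, o_coe] at n1 n2
        by_cases hk : k < n
        · rw [Nat.mod_eq_of_lt hk] at h3 n1 n2
          omega
        · rw [Nat.mod_eq_sub_mod (by omega), Nat.mod_eq_of_lt (by omega)] at h3 n1 n2
          omega)
      (fun k h => Finset.disjoint_left.1 hd h.2 h.1)
    exact (hna k).2 ⟨hk1, hk2⟩

theorem interval_of_no_split {n : ℕ} [NeZero n] {F : Finset (Fin n)} (h1 : F.Nonempty)
    (h2 : Fᶜ.Nonempty)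
    (h : ∀ X Y : Finset (Fin n), X ∪ Y = Fᶜ → Disjoint X Y → X.Nonempty → Y.Nonempty → ¬ NA X Y) :
    ∃ s t, F = win n s t := by
  obtain ⟨k, hk, hk'⟩ := exists_bd h1 h2
  have hex : ∃ j, o n (k + 1 + j) ∈ F := ⟨n - 1, by
    have := NeZero.ne n
    rw [show k + 1 + (n - 1) = k + n by omega, o_add]; exact hk⟩
  classical
  set j := Nat.find hex with hj
  have hjF : o n (k + 1 + j) ∈ F := Nat.find_spec hex
  have hjmin : ∀ i, i < j → o n (k + 1 + i) ∉ F := fun i hi => Nat.find_min hex hi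
  have hjn : j ≤ n - 1 := Nat.find_min' hex (by
    have := NeZero.ne n
    rw [show k + 1 + (n - 1) = k + n by omega, o_add]; exact hk)
  set X := win n (k + 1) (k + 1 + j) with hX
  have hXF : X ⊆ Fᶜ := by
    intro x hx
    obtain ⟨m, hm1, hm2, rfl⟩ := mem_win.1 hx
    rw [Finset.mem_compl]
    have := hjmin (m - (k + 1)) (by omega)
    rwa [show k + 1 + (m - (k + 1)) = m by omega] at this
  have hXe : X = Fᶜ := by
    by_contra hne
    have hYne : (Fᶜ \ X).Nonempty := by
      rw [Finset.sdiff_nonempty]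
      exact fun hh => hne (Finset.Subset.antisymm hXF hh)
    have hj0 : 0 < j := by
      by_contra h0
      have : j = 0 := by omega
      rw [this] at hjF
      exact hk' hjF
    refine h X (Fᶜ \ X) (by simpa using hXF) (Finset.disjoint_sdiff)
      ⟨o n (k + 1), mem_win.2 ⟨k + 1, le_rfl, by omega, rfl⟩⟩ hYne ?_
    intro i
    constructor
    · rintro ⟨hi1, hi2⟩
      obtain ⟨m, hm1, hm2, hm⟩ := mem_win.1 hi1
      have hm' : o n (m + 1) = o n (i + 1) := o_succ.2 hm
      simp only [Finset.mem_sdiff, Finset.mem_compl] at hi2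
      by_cases hlt : m + 1 < k + 1 + j
      · exact hi2.2 (mem_win.2 ⟨m + 1, by omega, hlt, hm'⟩)
      · rw [← hm', show m + 1 = k + 1 + j by omega] at hi2
        exact hi2.1 hjF
    · rintro ⟨hi1, hi2⟩
      obtain ⟨m, hm1, hm2, hm⟩ := mem_win.1 hi2
      simp only [Finset.mem_sdiff, Finset.mem_compl] at hi1
      obtain ⟨m, rfl⟩ : ∃ m', m = m' + 1 := ⟨m - 1, by omega⟩
      have hm' : o n m = o n i := o_succ.1 hm
      by_cases hlt : k + 1 ≤ m
      · exact hi1.2 (mem_win.2 ⟨m, by omega, by omega, hm'⟩)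
      · rw [← hm', show m = k by omega] at hi1
        exact hi1.1 hk
  refine ⟨k + 1 + j, k + 1 + n, ?_⟩
  ext x
  have hF : x ∈ F ↔ x ∉ X := by rw [hXe]; simp
  rw [hF]
  have hn := NeZero.ne n
  constructor
  · intro hx
    obtain ⟨m, hm1, hm2, hm⟩ : ∃ m, k + 1 ≤ m ∧ m < k + 1 + n ∧ o n m = x := by
      have : ∃ q, k + 1 ≤ x.val + n * q ∧ x.val + n * q < k + 1 + n := by
        refine ⟨(k + n - x.val) / n, ?_⟩
        have e1 := Nat.div_add_mod (k + n - x.val) n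
        have e2 := Nat.mod_lt (k + n - x.val) (Nat.pos_of_ne_zero hn)
        have := x.2
        omega
      obtain ⟨q, hq1, hq2⟩ := this
      refine ⟨_, hq1, hq2, ?_⟩
      conv_rhs => rw [← o_val x]
      rw [o_eq_iff]
      simp [Nat.ModEq]
    refine mem_win.2 ⟨m, ?_, hm2, hm⟩
    by_contra hlt
    exact hx (mem_win.2 ⟨m, hm1, by omega, hm⟩)
  · intro hx hx'
    obtain ⟨m, hm1, hm2, hm⟩ := mem_win.1 hx
    obtain ⟨m', hm1', hm2', hm'⟩ := mem_win.1 hx'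
    have : m ≡ m' [MOD n] := o_eq_iff.1 (hm.trans hm'.symm)
    have h3 := (Nat.modEq_iff_dvd' (by omega)).1 this.symm
    have h4 := Nat.le_of_dvd (by omega) h3
    omega

end Posi

open Finset

namespace Posi
open Submodule Module

theorem cross_symm {d n : ℕ} {A : Matrix (Fin d) (Fin n) ℝ} (hA : A.TotallyNonneg)
    {U : Finset (Fin n)} {a c x y : Fin n} (hU : U.card + 2 = d)
    (ha : (x < a ∧ a < y) ∨ (y < a ∧ a < x))
    (hc : (c < x ∧ c < y) ∨ (x < c ∧ y < c))
    (haU : a ∉ U) (hcU : c ∉ U) (hxU : x ∉ U) (hyU : y ∉ U)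
    (h1 : LinearIndepOn ℝ (cv A) ((insert a (insert x U) : Finset _) : Set (Fin n)))
    (h2 : LinearIndepOn ℝ (cv A) ((insert a (insert y U) : Finset _) : Set (Fin n)))
    (h3 : LinearIndepOn ℝ (cv A) ((insert c (insert x U) : Finset _) : Set (Fin n)))
    (h4 : LinearIndepOn ℝ (cv A) ((insert c (insert y U) : Finset _) : Set (Fin n))) :
    LinearIndepOn ℝ (cv A) ((insert a (insert c U) : Finset _) : Set (Fin n)) := by
  rcases ha with ha | ha <;> rcases hc with hc | hc
  · exact cross hA hU hc.1 ha.1 (Or.inr ha.2) hcU haU hxU hyU h3 h1 h4 h2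
  · rw [Finset.insert_comm]
    exact cross hA hU ha.2 hc.2 (Or.inl ha.1) haU hcU hyU hxU h2 h4 h1 h3
  · exact cross hA hU hc.2 ha.1 (Or.inr ha.2) hcU haU hyU hxU h4 h2 h3 h1
  · rw [Finset.insert_comm]
    exact cross hA hU ha.2 hc.1 (Or.inl ha.1) haU hcU hxU hyU h1 h3 h2 h4

theorem rk_univ {d n : ℕ} {A : Matrix (Fin d) (Fin n) ℝ} (hA : A.TotallyNonneg) :
    rk (cv A) Finset.univ = d := by
  have h := hA.1
  rw [Matrix.rank_eq_finrank_span_cols] at h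
  unfold rk sp
  rw [Finset.coe_univ, Set.image_univ]
  exact h

theorem card_le_rk {d n : ℕ} (A : Matrix (Fin d) (Fin n) ℝ) {B F : Finset (Fin n)}
    (hB : LinearIndepOn ℝ (cv A) (B : Set (Fin n))) : (B ∩ F).card ≤ rk (cv A) F := by
  rw [← (li_iff (cv A) (B ∩ F)).1 (hB.mono (by simp))]
  exact rk_mono _ Finset.inter_subset_right

set_option maxHeartbeats 1600000 in
theorem step {d n : ℕ} [NeZero n] {A : Matrix (Fin d) (Fin n) ℝ} (hA : A.TotallyNonneg)
    {B F X Y : Finset (Fin n)} (hB : B.card = d) (hF : rk (cv A) F < (B ∩ F).card)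
    (hXY : X ∪ Y = Fᶜ) (hd : Disjoint X Y) (hX : X.Nonempty) (hY : Y.Nonempty) (hna : NA X Y) :
    ∃ F', bd F' < bd F ∧ rk (cv A) F' < (B ∩ F').card := by
  have hmem : ∀ z, z ∈ F ↔ z ∉ X ∧ z ∉ Y := by
    intro z
    have : z ∈ X ∪ Y ↔ z ∉ F := by rw [hXY, Finset.mem_compl]
    rw [Finset.mem_union] at this
    tauto
  have hXd : ∀ z, z ∈ X → z ∉ Y := fun z h => Finset.disjoint_left.1 hd h
  have hFX : Disjoint F X := by
    rw [Finset.disjoint_left]; intro z hz; exact ((hmem z).1 hz).1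
  have hFY : Disjoint F Y := by
    rw [Finset.disjoint_left]; intro z hz; exact ((hmem z).1 hz).2
  have huniv : F ∪ X ∪ Y = Finset.univ := by
    ext z; simp only [Finset.mem_union, Finset.mem_univ, iff_true]; have := hmem z; tauto
  by_cases hmod : rk (cv A) (F ∪ X) + rk (cv A) (F ∪ Y) ≤ rk (cv A) (F ∪ X ∪ Y) + rk (cv A) F
  · rw [huniv, rk_univ hA] at hmod
    have hbd := bd_split hd hna hX hY
    rw [hXY, bd_compl] at hbd
    have e1 : (F ∪ X)ᶜ = Y := by
      ext z; simp only [Finset.mem_compl, Finset.mem_union]; have := hmem z; have := hXd z; tauto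
    have e2 : (F ∪ Y)ᶜ = X := by
      ext z; simp only [Finset.mem_compl, Finset.mem_union]; have := hmem z; have := hXd z; tauto
    have hcard : (B ∩ (F ∪ X)).card + (B ∩ (F ∪ Y)).card = d + (B ∩ F).card := by
      rw [← Finset.card_union_add_card_inter]
      congr 1
      · rw [← hB]; congr 1; ext z
        have := hmem z
        simp only [Finset.mem_union, Finset.mem_inter]; tauto
      · congr 1; ext z
        have := hmem z; have := hXd z
        simp only [Finset.mem_union, Finset.mem_inter]; tauto
    by_cases h1 : rk (cv A) (F ∪ X) < (B ∩ (F ∪ X)).card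
    · exact ⟨F ∪ X, by rw [← bd_compl, e1]; exact hbd.2, h1⟩
    · exact ⟨F ∪ Y, by rw [← bd_compl, e2]; exact hbd.1, by omega⟩
  · push Not at hmod
    obtain ⟨R, -, hRli, hRsp, hRF, y, hyR, hyY, x, hxX, hxR, hRx⟩ :=
      exists_exch (cv A) hFX hFY hd hmod
    have hRcard : R.card = d := by
      have e1 := (li_iff _ R).1 hRli
      have e2 := rk_univ hA
      rw [← huniv] at e2
      unfold rk at e1 e2
      rw [hRsp] at e1
      omega
    have hxF : x ∉ F := fun h => Finset.disjoint_left.1 hFX h hxX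
    have hyF : y ∉ F := fun h => Finset.disjoint_left.1 hFY h hyY
    have hxy : x ≠ y := by rintro rfl; exact hxR hyR
    set P := F.filter (fun a => (x < a ∧ a < y) ∨ (y < a ∧ a < x)) with hP
    set Q := F.filter (fun c => (c < x ∧ c < y) ∨ (x < c ∧ y < c)) with hQ
    have hPQd : Disjoint P Q := by
      rw [Finset.disjoint_left]
      intro z hz hz'
      simp only [hP, hQ, Finset.mem_filter] at hz hz'
      omega
    have hPQ : P ∪ Q = F := by
      ext z
      simp only [hP, hQ, Finset.mem_filter, Finset.mem_union]
      constructor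
      · tauto
      · intro hz
        have hzx : z.val ≠ x.val := fun h => hxF (Fin.ext h ▸ hz)
        have hzy : z.val ≠ y.val := fun h => hyF (Fin.ext h ▸ hz)
        have : ((x < z ∧ z < y) ∨ (y < z ∧ z < x)) ∨ ((z < x ∧ z < y) ∨ (x < z ∧ y < z)) := by
          omega
        exact this.imp (fun h => ⟨hz, h⟩) (fun h => ⟨hz, h⟩)
    have hne : P.Nonempty ∧ Q.Nonempty := by
      rcases lt_or_gt_of_ne hxy with hlt | hlt
      · obtain ⟨⟨a, haF, ha⟩, ⟨c, hcF, hc⟩⟩ := sides huniv hFX hFY hd hna hxX hyY hlt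
        exact ⟨⟨a, by simp only [hP, Finset.mem_filter]; tauto⟩,
          ⟨c, by simp only [hQ, Finset.mem_filter]; exact ⟨hcF, by omega⟩⟩⟩
      · obtain ⟨⟨a, haF, ha⟩, ⟨c, hcF, hc⟩⟩ := sides (X := Y) (Y := X)
          (by rw [← huniv]; ext z; simp only [Finset.mem_union]; tauto) hFY hFX hd.symm
          (fun k => (hna k).symm) hyY hxX hlt
        exact ⟨⟨a, by simp only [hP, Finset.mem_filter]; tauto⟩,
          ⟨c, by simp only [hQ, Finset.mem_filter]; exact ⟨hcF, by omega⟩⟩⟩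
    have hsucc : ∀ k, (o n (k + 1) : ℕ) = (o n k : ℕ) + 1 ∨
        ((o n (k + 1) : ℕ) = 0 ∧ (o n k : ℕ) = n - 1) := by
      intro k
      have hn := Nat.pos_of_ne_zero (NeZero.ne n)
      have h1 := Nat.mod_lt k hn
      rw [o_coe, o_coe]
      by_cases h : k % n + 1 < n
      · left
        rw [← Nat.mod_add_mod, Nat.mod_eq_of_lt h]
      · right
        have h2 : k % n + 1 = n := by omega
        rw [← Nat.mod_add_mod, h2, Nat.mod_self]
        omega
    have hnaPQ : NA P Q := by
      intro k
      simp only [hP, hQ, Finset.mem_filter, Fin.lt_def]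
      have := hsucc k
      have := x.2
      have := y.2
      omega
    have hbd := bd_split hPQd hnaPQ hne.1 hne.2
    rw [hPQ] at hbd
    have hrk : rk (cv A) P + rk (cv A) Q ≤ rk (cv A) F := by
      by_contra hcon
      push Not at hcon
      obtain ⟨S, hSF, hSli, hSsp, -, c, hcS, hcQ, a, haP, haS, hSa⟩ :=
        exists_exch (cv A) (F := ∅) (X := P) (Y := Q) (by simp) (by simp) hPQd (by
          simp only [Finset.empty_union]
          rw [hPQ]
          have : rk (cv A) ∅ = 0 := by
            have := rk_le_card (cv A) ∅
            simpa using this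
          omega)
      rw [Finset.empty_union, hPQ] at hSF hSsp
      have haF : a ∈ F := (Finset.mem_filter.1 haP).1
      have hcF : c ∈ F := hSF hcS
      have hScard : S.card = rk (cv A) F := by
        rw [← (li_iff _ S).1 hSli]; unfold rk; rw [hSsp]
      set S' := insert a (S.erase c) with hS'
      have hS'F : S' ⊆ F := by
        intro z hz
        simp only [hS', Finset.mem_insert, Finset.mem_erase] at hz
        rcases hz with rfl | hz
        · exact haF
        · exact hSF hz.2
      have hS'card : S'.card = rk (cv A) F := by
        rw [hS', Finset.card_insert_of_notMem (by simp [haS]), Finset.card_erase_add_one hcS, hScard]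
      -- independent subsets of `F` of full size span `F`
      have hspan : ∀ S₁ ⊆ F, LinearIndepOn ℝ (cv A) (S₁ : Set (Fin n)) → S₁.card = rk (cv A) F →
          sp (cv A) S₁ = sp (cv A) F := by
        intro S₁ h1 h2 h3
        apply Submodule.eq_of_le_of_finrank_eq (sp_mono _ h1)
        have := (li_iff _ S₁).1 h2
        unfold rk at this h3
        omega
      have hRFli : LinearIndepOn ℝ (cv A) ((R ∩ F : Finset _) : Set (Fin n)) :=
        hRli.mono (by simp)
      set T := R \ F with hT
      have hyT : y ∈ T := by simp [hT, hyR, hyF]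
      have hxT : x ∉ T := by simp [hT, hxR]
      have key : ∀ S₁ ⊆ F, LinearIndepOn ℝ (cv A) (S₁ : Set (Fin n)) → S₁.card = rk (cv A) F →
          LinearIndepOn ℝ (cv A) ((S₁ ∪ T : Finset _) : Set (Fin n)) ∧
          LinearIndepOn ℝ (cv A) ((S₁ ∪ insert x (T.erase y) : Finset _) : Set (Fin n)) := by
        intro S₁ h1 h2 h3
        constructor
        · refine li_replace (cv A) (S := R ∩ F) ?_ ?_ ?_ (by omega)
          · rwa [hT, Finset.union_comm, Finset.sdiff_union_inter]
          · rw [Finset.disjoint_left]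
            intro z; simp [hT]; tauto
          · rw [hspan _ h1 h2 h3, hspan _ Finset.inter_subset_right hRFli hRF]
        · refine li_replace (cv A) (S := R ∩ F) ?_ ?_ ?_ (by omega)
          · convert hRx using 2
            ext z
            simp only [hT, Finset.mem_union, Finset.mem_inter, Finset.mem_insert,
              Finset.mem_erase, Finset.mem_sdiff]
            have : z = y → z ∉ F := by rintro rfl; exact hyF
            tauto
          · rw [Finset.disjoint_left]
            intro z
            simp only [hT, Finset.mem_inter, Finset.mem_insert,
              Finset.mem_erase, Finset.mem_sdiff]
            have : z = x → z ∉ F := by rintro rfl; exact hxF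
            tauto
          · rw [hspan _ h1 h2 h3, hspan _ Finset.inter_subset_right hRFli hRF]
      obtain ⟨k1, k2⟩ := key S hSF hSli hScard
      obtain ⟨k3, k4⟩ := key S' hS'F hSa hS'card
      set U := S.erase c ∪ T.erase y with hU
      have hac : a ≠ c := by rintro rfl; exact haS hcS
      have hTF : ∀ z ∈ T, z ∉ F := by intro z; simp [hT]
      have hUc : U.card + 2 = d := by
        have e1 : T.card + (R ∩ F).card = R.card := by
          rw [hT]; exact Finset.card_sdiff_add_card_inter R F
        have e2 := Finset.card_erase_add_one hcS
        have e3 := Finset.card_erase_add_one hyT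
        rw [hU, Finset.card_union_of_disjoint]
        · omega
        · rw [Finset.disjoint_left]
          intro z hz hz'
          exact hTF z (Finset.mem_of_mem_erase hz') (hSF (Finset.mem_of_mem_erase hz))
      have haU : a ∉ U := by
        simp only [hU, Finset.mem_union, Finset.mem_erase]
        have := hTF a
        tauto
      have hcU : c ∉ U := by
        simp only [hU, Finset.mem_union, Finset.mem_erase]
        have := hTF c
        tauto
      have hxU : x ∉ U := by
        simp only [hU, Finset.mem_union, Finset.mem_erase]
        have := @hSF x
        tauto
      have hyU : y ∉ U := by
        simp only [hU, Finset.mem_union, Finset.mem_erase]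
        have := @hSF y
        tauto
      have hfin := cross_symm hA hUc (Finset.mem_filter.1 haP).2 (Finset.mem_filter.1 hcQ).2
        haU hcU hxU hyU
        (by
          convert k4 using 2
          ext z
          simp only [hU, hS', Finset.mem_union, Finset.mem_insert, Finset.mem_erase]
          grind)
        (by
          convert k3 using 2
          ext z
          simp only [hU, hS', Finset.mem_union, Finset.mem_insert, Finset.mem_erase]
          have : z = y → z ∈ T := by rintro rfl; exact hyT
          grind)
        (by
          convert k2 using 2
          ext z
          simp only [hU, Finset.mem_union, Finset.mem_insert, Finset.mem_erase]
          have : z = c → z ∈ S := by rintro rfl; exact hcS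
          grind)
        (by
          convert k1 using 2
          ext z
          simp only [hU, Finset.mem_union, Finset.mem_insert, Finset.mem_erase]
          have : z = y → z ∈ T := by rintro rfl; exact hyT
          have : z = c → z ∈ S := by rintro rfl; exact hcS
          grind)
      have hle := card_le_rk A (F := F) hfin
      have hsub : insert a S ⊆ insert a (insert c U) ∩ F := by
        intro z
        simp only [hU, Finset.mem_union, Finset.mem_insert, Finset.mem_erase, Finset.mem_inter]
        have : z = a → z ∈ F := by rintro rfl; exact haF
        have := @hSF z
        tauto
      have := Finset.card_le_card hsub
      rw [Finset.card_insert_of_notMem haS] at this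
      omega
    have hcard : (B ∩ P).card + (B ∩ Q).card = (B ∩ F).card := by
      rw [← hPQ, Finset.inter_union_distrib_left, Finset.card_union_of_disjoint]
      exact hPQd.mono Finset.inter_subset_right Finset.inter_subset_right
    by_cases h1 : rk (cv A) P < (B ∩ P).card
    · exact ⟨P, hbd.1, h1⟩
    · exact ⟨Q, hbd.2, by omega⟩

theorem viol_aux {d n : ℕ} [NeZero n] {A : Matrix (Fin d) (Fin n) ℝ} (hA : A.TotallyNonneg)
    {B : Finset (Fin n)} (hB : B.card = d) (N : ℕ) : ∀ F : Finset (Fin n), bd F = N →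
    rk (cv A) F < (B ∩ F).card → ∃ s t, rk (cv A) (win n s t) < (B ∩ win n s t).card := by
  induction N using Nat.strong_induction_on with
  | _ N ih =>
    intro F hN hF
    by_cases hsplit : ∃ X Y : Finset (Fin n), X ∪ Y = Fᶜ ∧ Disjoint X Y ∧ X.Nonempty ∧ Y.Nonempty ∧
        NA X Y
    · obtain ⟨X, Y, h1, h2, h3, h4, h5⟩ := hsplit
      obtain ⟨F', h6, h7⟩ := step hA hB hF h1 h2 h3 h4 h5
      exact ih _ (hN ▸ h6) F' rfl h7
    · push Not at hsplit
      have hne : F.Nonempty := by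
        rw [Finset.nonempty_iff_ne_empty]
        rintro rfl
        simp at hF
      have hne' : Fᶜ.Nonempty := by
        rw [Finset.nonempty_iff_ne_empty]
        intro h
        rw [Finset.compl_eq_empty_iff] at h
        rw [h, rk_univ hA, Finset.inter_univ] at hF
        omega
      obtain ⟨s, t, rfl⟩ := interval_of_no_split hne hne' hsplit
      exact ⟨s, t, hF⟩

/-- Every dependent `d`-set violates the rank bound of some cyclic interval. -/
theorem viol {d n : ℕ} [NeZero n] {A : Matrix (Fin d) (Fin n) ℝ} (hA : A.TotallyNonneg)
    {B : Finset (Fin n)} (hB : B.card = d) (hnot : ¬ LinearIndepOn ℝ (cv A) (B : Set (Fin n))) :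
    ∃ s t, rk (cv A) (win n s t) < (B ∩ win n s t).card := by
  refine viol_aux hA hB _ B rfl ?_
  rw [li_iff] at hnot
  have := rk_le_card (cv A) B
  rw [Finset.inter_self]
  omega

end Posi

open Finset

namespace Posi
open Submodule Module

section Win
variable {n : ℕ} [NeZero n]

theorem win_self (s : ℕ) : win n s s = ∅ := by simp [win]

theorem win_succ_right {s t : ℕ} (h : s ≤ t) : win n s (t + 1) = insert (o n t) (win n s t) := by
  unfold win
  rw [← Finset.insert_Ico_right_eq_Ico_add_one h, Finset.image_insert]

theorem win_succ_left {s t : ℕ} (h : s < t) : win n s t = insert (o n s) (win n (s + 1) t) := by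
  unfold win
  rw [← Finset.insert_Ico_add_one_left_eq_Ico h, Finset.image_insert]

theorem win_mono {s t s' t' : ℕ} (h : s' ≤ s) (h' : t ≤ t') : win n s t ⊆ win n s' t' :=
  Finset.image_subset_image (Finset.Ico_subset_Ico h h')

theorem win_shift (s t : ℕ) : win n (s + n) (t + n) = win n s t := by
  ext x
  rw [mem_win, mem_win]
  constructor
  · rintro ⟨k, h1, h2, h3⟩
    refine ⟨k - n, by omega, by omega, ?_⟩
    rw [← h3, ← o_add, show k - n + n = k by omega]
  · rintro ⟨k, h1, h2, h3⟩
    exact ⟨k + n, by omega, by omega, by rw [o_add, h3]⟩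

theorem o_mem_win {s t k : ℕ} (h1 : s ≤ k) (h2 : k < t) : o n k ∈ win n s t :=
  mem_win.2 ⟨k, h1, h2, rfl⟩

end Win

section FA
variable {n : ℕ} [NeZero n] {V : Type*} [AddCommGroup V] [Module ℝ V] (v : Fin n → V)

/-- affine permutation of a vector configuration -/
noncomputable def fA (i : ℕ) : ℕ :=
  sInf {m | i ≤ m ∧ v (o n i) ∈ sp v (win n (i + 1) (m + 1))}

theorem fA_set_nonempty (i : ℕ) :
    i + n ∈ {m | i ≤ m ∧ v (o n i) ∈ sp v (win n (i + 1) (m + 1))} := by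
  refine ⟨by omega, ?_⟩
  rw [← o_add]
  apply mem_sp
  have := Nat.pos_of_ne_zero (NeZero.ne n)
  exact o_mem_win (by omega) (by omega)

theorem fA_le (i : ℕ) : fA v i ≤ i + n := Nat.sInf_le (fA_set_nonempty v i)

theorem le_fA (i : ℕ) : i ≤ fA v i := (Nat.sInf_mem ⟨_, fA_set_nonempty v i⟩).1

theorem fA_spec {i m : ℕ} (h : i ≤ m) :
    v (o n i) ∈ sp v (win n (i + 1) (m + 1)) ↔ fA v i ≤ m := by
  constructor
  · intro h2
    exact Nat.sInf_le ⟨h, h2⟩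
  · intro h2
    have := (Nat.sInf_mem ⟨_, fA_set_nonempty v i⟩).2
    exact sp_mono v (win_mono le_rfl (by unfold fA at h2; omega)) this

theorem fA_eq_of {i m : ℕ} (h : i ≤ m)
    (hm : ∀ m', i ≤ m' → (v (o n i) ∈ sp v (win n (i + 1) (m' + 1)) ↔ m ≤ m')) : fA v i = m := by
  apply le_antisymm
  · rw [← fA_spec v h, hm m h]
  · rw [← hm _ (le_fA v i), fA_spec v (le_fA v i)]

theorem fA_add (i : ℕ) : fA v (i + n) = fA v i + n := by
  apply fA_eq_of
  · have := le_fA v i; omega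
  · intro m' hm'
    obtain ⟨m, rfl⟩ : ∃ m, m' = m + n := ⟨m' - n, by omega⟩
    rw [o_add, show i + n + 1 = i + 1 + n by omega, show m + n + 1 = m + 1 + n by omega, win_shift,
      fA_spec v (by omega)]
    omega

theorem fA_add_mul (i c : ℕ) : fA v (i + c * n) = fA v i + c * n := by
  induction c with
  | zero => simp
  | succ c ih => rw [Nat.succ_mul, ← add_assoc, fA_add, ih]; omega

theorem fA_last (j : ℕ) : v (o n (fA v j)) ∈ sp v (win n j (fA v j)) := by
  have h1 := le_fA v j
  have h2 := (fA_spec v h1).2 le_rfl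
  rcases h1.eq_or_lt with h | h
  · rw [← h, win_self] at h2
    rw [← h, win_self]
    exact h2
  · have h3 : v (o n j) ∉ sp v (win n (j + 1) (fA v j)) := by
      obtain ⟨m, hm⟩ : ∃ m, fA v j = m + 1 := ⟨fA v j - 1, by omega⟩
      rw [hm, fA_spec v (by omega)]
      omega
    rw [win_succ_right (by omega)] at h2
    rw [win_succ_left h]
    unfold sp at h2 h3 ⊢
    rw [Finset.coe_insert, Set.image_insert_eq] at h2 ⊢
    exact mem_span_insert_exchange h2 h3

theorem fA_inj {i j : ℕ} (h : fA v i = fA v j) : i = j := by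
  have key : ∀ i j, fA v i = fA v j → i < j → False := by
    intro i j h hij
    have h1 := fA_last v j
    have h2 := le_fA v j
    rw [← h] at h1 h2
    have h3 := (fA_spec v (le_fA v i)).2 le_rfl
    rw [win_succ_right (by omega)] at h3
    have h4 : v (o n i) ∈ sp v (win n (i + 1) (fA v i)) := by
      rw [sp_insert, sup_eq_right.2] at h3
      · exact h3
      · rw [span_singleton_le_iff_mem]
        exact sp_mono v (win_mono (by omega) le_rfl) h1
    obtain ⟨m, hm⟩ : ∃ m, fA v i = m + 1 := ⟨fA v i - 1, by omega⟩
    rw [hm, fA_spec v (by omega)] at h4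
    omega
  rcases lt_trichotomy i j with h1 | h1 | h1
  · exact (key _ _ h h1).elim
  · exact h1
  · exact (key _ _ h.symm h1).elim

theorem fA_mod_inj {i j : ℕ} (hi : i < n) (hj : j < n) (h : fA v i % n = fA v j % n) : i = j := by
  have key : ∀ i j, i < n → j < n → fA v i % n = fA v j % n → fA v i ≤ fA v j → i = j := by
    intro i j hi hj h hle
    obtain ⟨c, hc⟩ := (Nat.modEq_iff_dvd' hle).1 h
    have : fA v (i + c * n) = fA v j := by
      rw [fA_add_mul, mul_comm]; omega
    have h2 := fA_inj v this
    rcases Nat.eq_zero_or_pos c with rfl | h3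
    · simpa using h2
    · have : n ≤ c * n := Nat.le_mul_of_pos_left n h3
      omega
  rcases le_total (fA v i) (fA v j) with h1 | h1
  · exact key _ _ hi hj h h1
  · exact (key _ _ hj hi h.symm h1).symm

theorem rk_win (s t : ℕ) : rk v (win n s t) = ((Finset.Ico s t).filter (fun k => t ≤ fA v k)).card := by
  have hz : rk v ∅ = 0 := by have := rk_le_card v ∅; simpa using this
  by_cases hst : s ≤ t
  · obtain ⟨c, rfl⟩ : ∃ c, t = s + c := ⟨t - s, by omega⟩
    clear hst
    induction c generalizing s with
    | zero => simp [win_self, hz]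
    | succ c ih =>
      have h1 := ih (s + 1)
      rw [show s + 1 + c = s + (c + 1) by omega] at h1
      rw [win_succ_left (by omega), ← Finset.insert_Ico_add_one_left_eq_Ico (by omega),
        Finset.filter_insert]
      have h2 := fA_spec v (i := s) (m := s + c) (by omega)
      rw [add_assoc s c 1] at h2
      split_ifs with h
      · rw [Finset.card_insert_of_notMem (by simp), ← h1, rk_insert_of_notMem]
        rw [h2]; omega
      · rw [← h1, rk_insert_of_mem]
        rw [h2]; omega
  · rw [show Finset.Ico s t = ∅ from Finset.Ico_eq_empty (by omega)]
    unfold win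
    rw [show Finset.Ico s t = ∅ from Finset.Ico_eq_empty (by omega)]
    simpa using hz

theorem win_full : win n 0 n = Finset.univ := by
  ext x
  rw [mem_win]
  simp only [Finset.mem_univ, iff_true]
  exact ⟨x.val, by omega, x.2, o_val x⟩

end FA

theorem fA_ext {n : ℕ} [NeZero n] {V V' : Type*} [AddCommGroup V] [Module ℝ V] [AddCommGroup V']
    [Module ℝ V'] {v : Fin n → V} {v' : Fin n → V'}
    (h : ∀ i < n, fA v i = fA v' i) : ∀ i, fA v i = fA v' i := by
  intro i
  have h1 := Nat.mod_lt i (Nat.pos_of_ne_zero (NeZero.ne n))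
  have h2 := Nat.mod_add_div' i n
  rw [← h2, fA_add_mul, fA_add_mul, h _ h1]

/-- bases are determined by the affine permutation -/
theorem bases_eq {n d d' : ℕ} [NeZero n] {A : Matrix (Fin d) (Fin n) ℝ} (hA : A.TotallyNonneg)
    {A' : Matrix (Fin d') (Fin n) ℝ} (hA' : A'.TotallyNonneg)
    (h : ∀ i < n, fA (cv A) i = fA (cv A') i) :
    d = d' ∧ ∀ B : Finset (Fin n), B.card = d →
      (LinearIndepOn ℝ (cv A) (B : Set (Fin n)) ↔ LinearIndepOn ℝ (cv A') (B : Set (Fin n))) := by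
  have h1 := fA_ext h
  have h2 : ∀ s t, rk (cv A) (win n s t) = rk (cv A') (win n s t) := by
    intro s t
    rw [rk_win, rk_win]
    simp only [h1]
  have hd : d = d' := by
    have := h2 0 n
    rw [win_full, rk_univ hA, rk_univ hA'] at this
    exact this
  refine ⟨hd, fun B hB => ⟨fun hli => ?_, fun hli => ?_⟩⟩
  · by_contra hcon
    obtain ⟨s, t, hst⟩ := viol hA' (hB.trans hd) hcon
    have := card_le_rk A (F := win n s t) hli
    rw [h2] at this
    omega
  · by_contra hcon
    obtain ⟨s, t, hst⟩ := viol hA hB hcon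
    have := card_le_rk A' (F := win n s t) hli
    rw [h2] at hst
    omega

end Posi

open Finset

namespace Posi
open Submodule Module

section Gen
variable {n : ℕ} [NeZero n]

theorem rank_eq_count {d : ℕ} (A : Matrix (Fin d) (Fin n) ℝ) :
    A.rank = (Finset.univ.filter (fun i : Fin n => n ≤ fA (cv A) i.val)).card := by
  have h : rk (cv A) Finset.univ = A.rank := by
    rw [Matrix.rank_eq_finrank_span_cols]
    unfold rk sp
    rw [Finset.coe_univ, Set.image_univ]
    rfl
  have h' := rk_win (cv A) 0 n
  rw [win_full] at h'
  rw [← h, h']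
  symm
  apply Finset.card_bij (fun i _ => i.val)
  · intro a ha
    simp only [Finset.mem_filter, Finset.mem_univ, true_and] at ha
    simp [ha]
  · intro a _ b _ hab
    exact Fin.ext hab
  · intro b hb
    simp only [Finset.mem_filter, Finset.mem_Ico] at hb
    exact ⟨⟨b, hb.1.2⟩, by simpa using hb.2, rfl⟩

theorem fA_congr {V V' : Type*} [AddCommGroup V] [Module ℝ V] [AddCommGroup V']
    [Module ℝ V'] {v : Fin n → V} {v' : Fin n → V'} {i : ℕ}
    (h : ∀ m, i ≤ m → m < i + n → (v (o n i) ∈ sp v (win n (i + 1) (m + 1)) ↔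
      v' (o n i) ∈ sp v' (win n (i + 1) (m + 1)))) : fA v i = fA v' i := by
  have hn := Nat.pos_of_ne_zero (NeZero.ne n)
  apply fA_eq_of
  · exact le_fA _ _
  · intro m hm
    by_cases h2 : m < i + n
    · rw [h m hm h2, fA_spec _ hm]
    · refine iff_of_true ?_ ((fA_le v' i).trans (by omega))
      rw [fA_spec _ hm]
      exact (fA_le v i).trans (by omega)

theorem fA_eq_of' {V : Type*} [AddCommGroup V] [Module ℝ V] (v : Fin n → V) {i m : ℕ} (h : i ≤ m)
    (h' : m ≤ i + n)
    (hm : ∀ m', i ≤ m' → m' < i + n → (v (o n i) ∈ sp v (win n (i + 1) (m' + 1)) ↔ m ≤ m')) :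
    fA v i = m := by
  apply fA_eq_of _ h
  intro m' hm'
  by_cases h2 : m' < i + n
  · exact hm m' hm' h2
  · refine iff_of_true ?_ (by omega)
    rw [fA_spec _ hm']
    exact (fA_le v i).trans (by omega)

theorem o_eq_val {k : ℕ} {x : Fin n} (h : o n k = x) : k % n = x.val := by
  rw [← h, o_coe]

/-- windows of length less than `n` do not wrap around -/
theorem notMem_win {i : Fin n} {m : ℕ} (hm : m < i.val + n) : i ∉ win n (i.val + 1) (m + 1) := by
  rw [mem_win]
  rintro ⟨k, h1, h2, h3⟩
  have h4 := o_eq_val h3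
  have h5 : k ≡ i.val [MOD n] := by
    unfold Nat.ModEq; rw [h4, Nat.mod_eq_of_lt i.2]
  obtain ⟨c, hc⟩ := (Nat.modEq_iff_dvd' (by omega : i.val ≤ k)).1 h5.symm
  rcases Nat.eq_zero_or_pos c with rfl | h6
  · omega
  · have : n ≤ n * c := Nat.le_mul_of_pos_right n h6
    omega

end Gen

section Coloop
variable {n : ℕ} [NeZero n] {d : ℕ}

/-- sign used in the coloop extension -/
noncomputable def eps (k j : Fin n) : ℝ := if j < k then -1 else 1

theorem eps_mul (k j : Fin n) : eps k j * eps k j = 1 := by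
  unfold eps; split_ifs <;> norm_num

/-- adjoin a coloop -/
noncomputable def colA (A : Matrix (Fin d) (Fin n) ℝ) (k : Fin n) : Matrix (Fin (d + 1)) (Fin n) ℝ :=
  Matrix.of (Fin.cons (fun j => if j = k then 1 else 0) (fun i j => eps k j * A i j))

theorem colA_zero (A : Matrix (Fin d) (Fin n) ℝ) (k j : Fin n) :
    colA A k 0 j = if j = k then 1 else 0 := by simp [colA]

theorem colA_succ (A : Matrix (Fin d) (Fin n) ℝ) (k j : Fin n) (i : Fin d) :
    colA A k i.succ j = eps k j * A i j := by simp [colA]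

theorem colA_mem_iff (A : Matrix (Fin d) (Fin n) ℝ) {k : Fin n} (hk : ∀ i, A i k = 0)
    {j : Fin n} (hj : j ≠ k) (W : Finset (Fin n)) :
    cv (colA A k) j ∈ sp (cv (colA A k)) W ↔ cv A j ∈ sp (cv A) W := by
  let P : (Fin (d + 1) → ℝ) →ₗ[ℝ] (Fin d → ℝ) :=
    { toFun := fun x i => x i.succ
      map_add' := by intros; rfl
      map_smul' := by intros; rfl }
  let L : (Fin d → ℝ) →ₗ[ℝ] (Fin (d + 1) → ℝ) :=
    { toFun := fun x => Fin.cons 0 x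
      map_add' := by intro x y; ext i; refine Fin.cases ?_ (fun i => ?_) i <;> simp
      map_smul' := by intro x y; ext i; refine Fin.cases ?_ (fun i => ?_) i <;> simp }
  have hP : ∀ j, P (cv (colA A k) j) = eps k j • cv A j := by
    intro j; ext i
    exact colA_succ A k j i
  have hL : ∀ j, j ≠ k → L (cv A j) = eps k j • cv (colA A k) j := by
    intro j hj; ext i
    refine Fin.cases ?_ (fun i => ?_) i
    · change (0 : ℝ) = eps k j * colA A k 0 j
      rw [colA_zero, if_neg hj, mul_zero]
    · change A i j = eps k j * colA A k i.succ j
      rw [colA_succ, ← mul_assoc, eps_mul, one_mul]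
  constructor
  · intro h
    have h1 : sp (cv (colA A k)) W ≤ (sp (cv A) W).comap P := by
      apply sp_le
      intro x hx
      rw [Submodule.mem_comap, hP]
      exact Submodule.smul_mem _ _ (mem_sp _ hx)
    have h2 := h1 h
    rw [Submodule.mem_comap, hP] at h2
    have h3 := Submodule.smul_mem _ (eps k j) h2
    rwa [smul_smul, eps_mul, one_smul] at h3
  · intro h
    have h1 : sp (cv A) W ≤ (sp (cv (colA A k)) W).comap L := by
      apply sp_le
      intro x hx
      rw [Submodule.mem_comap]
      by_cases hxk : x = k
      · have : cv A x = 0 := by ext i; rw [hxk]; exact hk i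
        rw [this, map_zero]
        exact zero_mem _
      · rw [hL x hxk]
        exact Submodule.smul_mem _ _ (mem_sp _ hx)
    have h2 := h1 h
    rw [Submodule.mem_comap, hL j hj] at h2
    have h3 := Submodule.smul_mem _ (eps k j) h2
    rwa [smul_smul, eps_mul, one_smul] at h3

theorem colA_notMem (A : Matrix (Fin d) (Fin n) ℝ) {k : Fin n} {W : Finset (Fin n)} (hW : k ∉ W) :
    cv (colA A k) k ∉ sp (cv (colA A k)) W := by
  intro h
  have h1 : sp (cv (colA A k)) W ≤ LinearMap.ker (LinearMap.proj (R := ℝ) (φ := fun _ => ℝ) (0 : Fin (d + 1))) := by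
    apply sp_le
    intro x hx
    rw [LinearMap.mem_ker]
    change colA A k 0 x = 0
    rw [colA_zero, if_neg]
    rintro rfl; exact hW hx
  have h2 := h1 h
  rw [LinearMap.mem_ker] at h2
  change colA A k 0 k = 0 at h2
  rw [colA_zero, if_pos rfl] at h2
  exact one_ne_zero h2

theorem colA_fA (A : Matrix (Fin d) (Fin n) ℝ) {k : Fin n} (hk : ∀ i, A i k = 0) (j : Fin n) :
    fA (cv (colA A k)) j.val = if j = k then k.val + n else fA (cv A) j.val := by
  split_ifs with h
  · subst h
    apply fA_eq_of' _ (by omega) le_rfl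
    intro m h1 h2
    refine iff_of_false ?_ (by omega)
    rw [o_val]
    exact colA_notMem A (notMem_win h2)
  · apply fA_congr
    intro m _ _
    rw [o_val]
    exact colA_mem_iff A hk h _

theorem colA_minor (A : Matrix (Fin d) (Fin n) ℝ)
    (hA : ∀ f : Fin d → Fin n, StrictMono f → 0 ≤ (A.submatrix id f).det) (k : Fin n)
    (f : Fin (d + 1) → Fin n) (hf : StrictMono f) : 0 ≤ ((colA A k).submatrix id f).det := by
  rw [Matrix.det_succ_row_zero]
  by_cases hex : ∃ p, f p = k
  · obtain ⟨p, hp⟩ := hex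
    rw [Finset.sum_eq_single p]
    · rw [Matrix.submatrix_apply, id, colA_zero, if_pos hp, mul_one]
      have h1 : ((colA A k).submatrix id f).submatrix Fin.succ p.succAbove =
          Matrix.of (fun i j => eps k (f (p.succAbove j)) *
            (A.submatrix id (f ∘ p.succAbove)) i j) := by
        ext i j
        simp [colA_succ]
      rw [h1, Matrix.det_mul_row]
      have h2 : ∏ j, eps k (f (p.succAbove j)) = (-1 : ℝ) ^ (p : ℕ) := by
        have : ∀ j, eps k (f (p.succAbove j)) = if (j : ℕ) < p then (-1 : ℝ) else 1 := by
          intro j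
          unfold eps
          rw [← hp]
          simp only [hf.lt_iff_lt]
          congr 1
          rw [Fin.succAbove_lt_iff_castSucc_lt]
          simp [Fin.lt_def]
        simp only [this]
        rw [Finset.prod_ite]
        simp only [Finset.prod_const, one_pow, mul_one]
        congr 1
        have h3 : ∀ q : ℕ, q < d + 1 → (Finset.univ.filter (fun x : Fin d => (x : ℕ) < q)).card = q := by
          intro q hq
          have : (Finset.univ.filter (fun x : Fin d => (x : ℕ) < q)).card = (Finset.range q).card := by
            apply Finset.card_bij (fun x _ => x.val)
            · intro a ha; simpa using ha
            · intro a _ b _ h; exact Fin.ext h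
            · intro b hb
              have hb' := Finset.mem_range.1 hb
              exact ⟨⟨b, by omega⟩, by simpa using hb', rfl⟩
          simpa using this
        exact h3 p p.2
      rw [h2, ← mul_assoc, ← pow_add, ← two_mul, pow_mul]
      norm_num
      exact hA _ (hf.comp (Fin.strictMono_succAbove p))
    · intro q _ hq
      rw [Matrix.submatrix_apply, id, colA_zero, if_neg]
      · simp
      · intro h
        exact hq (hf.injective (h.trans hp.symm))
    · simp
  · push Not at hex
    apply Finset.sum_nonneg
    intro q _
    rw [Matrix.submatrix_apply, id, colA_zero, if_neg (hex q)]
    simp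

theorem colA_tnn {A : Matrix (Fin d) (Fin n) ℝ} (hA : A.TotallyNonneg) {k : Fin n}
    (hk : ∀ i, A i k = 0) : (colA A k).TotallyNonneg := by
  refine ⟨?_, colA_minor A hA.2 k⟩
  have hfk : fA (cv A) k.val = k.val := by
    apply fA_eq_of' _ le_rfl (by omega)
    intro m h1 _
    refine iff_of_true ?_ h1
    rw [o_val]
    have : cv A k = 0 := by ext i; exact hk i
    rw [this]; exact zero_mem _
  have h := hA.1
  rw [rank_eq_count] at h ⊢
  have e : (Finset.univ.filter (fun i : Fin n => n ≤ fA (cv (colA A k)) i.val)) =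
      insert k (Finset.univ.filter (fun i : Fin n => n ≤ fA (cv A) i.val)) := by
    ext j
    simp only [Finset.mem_filter, Finset.mem_univ, true_and, Finset.mem_insert, colA_fA A hk]
    split_ifs with h
    · simp [h]
    · simp [h]
  rw [e, Finset.card_insert_of_notMem, h]
  simp only [Finset.mem_filter, Finset.mem_univ, true_and, hfk]
  have := k.2
  omega

end Coloop

end Posi

open Finset

namespace Posi
open Submodule Module

set_option linter.unusedSectionVars false

section Swap
variable {n : ℕ} [NeZero n] {V : Type*} [AddCommGroup V] [Module ℝ V]

theorem sp_skip (v : Fin n → V) {i j : Fin n} (hij : i < j) (hz : ∀ k, i < k → k < j → v k = 0)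
    {m : ℕ} (hm : j.val ≤ m) :
    sp v (win n (i.val + 1) (m + 1)) = span ℝ {v j} ⊔ sp v (win n (j.val + 1) (m + 1)) := by
  have hij' : i.val < j.val := hij
  apply le_antisymm
  · apply sp_le
    intro x hx
    obtain ⟨t, h1, h2, rfl⟩ := mem_win.1 hx
    rcases lt_trichotomy t j.val with h | h | h
    · have : v (o n t) = 0 := by
        have e : (o n t).val = t := by rw [o_coe, Nat.mod_eq_of_lt (h.trans j.2)]
        apply hz
        · rw [Fin.lt_def, e]; omega
        · rw [Fin.lt_def, e]; omega
      rw [this]; exact zero_mem _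
    · rw [h, o_val]
      exact Submodule.mem_sup_left (mem_span_singleton_self _)
    · exact Submodule.mem_sup_right (mem_sp v (o_mem_win (by omega) h2))
  · rw [sup_le_iff, span_singleton_le_iff_mem]
    constructor
    · apply mem_sp
      have := o_mem_win (n := n) (s := i.val + 1) (t := m + 1) (k := j.val) (by omega) (by omega)
      rwa [o_val] at this
    · exact sp_mono v (win_mono (by omega) le_rfl)

/-- bridge on vectors -/
def swv (v : Fin n → V) (i j : Fin n) : Fin n → V := Function.update v j (v j + v i)

theorem swv_self (v : Fin n → V) (i j : Fin n) : swv v i j j = v j + v i := by simp [swv]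

theorem swv_ne (v : Fin n → V) {i j k : Fin n} (h : k ≠ j) : swv v i j k = v k := by simp [swv, h]

theorem swv_sp (v : Fin n → V) {i j : Fin n} (hij : i ≠ j) {W : Finset (Fin n)}
    (hW : j ∈ W → i ∈ W) : sp (swv v i j) W = sp v W := by
  apply le_antisymm
  · apply sp_le
    intro x hx
    by_cases hxj : x = j
    · subst hxj
      rw [swv_self]
      exact add_mem (mem_sp v hx) (mem_sp v (hW hx))
    · rw [swv_ne v hxj]; exact mem_sp v hx
  · apply sp_le
    intro x hx
    by_cases hxj : x = j
    · subst hxj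
      have h1 := mem_sp (swv v i x) hx
      have h2 := mem_sp (swv v i x) (hW hx)
      rw [swv_self] at h1
      rw [swv_ne v hij] at h2
      have := sub_mem h1 h2
      rwa [add_sub_cancel_right] at this
    · have := mem_sp (swv v i j) hx
      rwa [swv_ne v hxj] at this

theorem swv_fA_j (v : Fin n → V) {i j : Fin n} (hij : i < j) (hz : ∀ k, i < k → k < j → v k = 0)
    (hb : j.val ≤ fA v j) (hbc : fA v j < fA v i) (hc : fA v i ≤ i.val + n) : fA (swv v i j) j = fA v i := by
  have hij' : i.val < j.val := hij
  apply fA_eq_of' _ (by omega) (by omega)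
  intro m hm hm'
  have hnj := notMem_win (i := j) hm'
  rw [o_val, swv_self, swv_sp v hij.ne (fun h => (hnj h).elim)]
  have h1 := fA_spec v (i := j.val) hm
  have h2 := fA_spec v (i := i.val) (m := m) (by omega)
  rw [o_val] at h1 h2
  rw [sp_skip v hij hz hm] at h2
  rw [← h2]
  constructor
  · intro h
    have : v i = (v j + v i) - v j := by abel
    rw [this]
    exact sub_mem (Submodule.mem_sup_right h)
      (Submodule.mem_sup_left (mem_span_singleton_self _))
  · intro h
    have hcm := h2.1 h
    have h3 := h1.2 (by omega)
    rw [sup_eq_right.2 (by rwa [span_singleton_le_iff_mem])] at h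
    exact add_mem h3 h

theorem swv_fA_i (v : Fin n → V) {i j : Fin n} (hij : i < j) (hz : ∀ k, i < k → k < j → v k = 0)
    (hb : j.val ≤ fA v j) (hbc : fA v j < fA v i) (hc : fA v i ≤ i.val + n) : fA (swv v i j) i = fA v j := by
  have hij' : i.val < j.val := hij
  apply fA_eq_of' _ (by omega) (by omega)
  intro m hm hm'
  rw [o_val]
  by_cases hmj : m < j.val
  · have hnj : j ∉ win n (i.val + 1) (m + 1) := by
      intro h
      exact notMem_win (i := j) (m := m + n) (by omega)
        (by rw [mem_win] at h ⊢
            obtain ⟨t, h1, h2, h3⟩ := h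
            exact ⟨t + n, by have := j.2; omega, by omega, by rw [o_add, h3]⟩)
    have h2 := fA_spec v (i := i.val) (m := m) hm
    rw [o_val] at h2
    rw [swv_ne v hij.ne, swv_sp v hij.ne (fun h => (hnj h).elim), h2]
    omega
  · have hmj' : j.val ≤ m := by omega
    have hnj := notMem_win (i := j) (m := m) (by omega)
    rw [sp_skip (swv v i j) hij (fun k h1 h2 => by rw [swv_ne v h2.ne]; exact hz k h1 h2) hmj',
      swv_self, swv_ne v hij.ne, swv_sp v hij.ne (fun h => (hnj h).elim)]
    have h1 := fA_spec v (i := j.val) hmj'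
    have h2 := fA_spec v (i := i.val) (m := m) (by omega)
    rw [o_val] at h1 h2
    rw [sp_skip v hij hz hmj'] at h2
    rw [← h1]
    constructor
    · intro h
      rw [Submodule.mem_sup] at h
      obtain ⟨y, hy, w, hw, hyw⟩ := h
      rw [mem_span_singleton] at hy
      obtain ⟨α, rfl⟩ := hy
      by_cases hα : α = 1
      · rw [hα, one_smul] at hyw
        have : v j = -w := by
          have : v j + w = 0 := by
            have := congrArg (fun z => z - v i) hyw
            simp only [sub_self] at this
            rw [← this]; abel
          exact eq_neg_of_add_eq_zero_left this
        rw [this]; exact neg_mem hw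
      · have hα' : (1 - α) ≠ 0 := sub_ne_zero.2 (Ne.symm hα)
        have e : v i = (1 - α)⁻¹ • (α • v j + w) := by
          rw [eq_inv_smul_iff₀ hα', sub_smul, one_smul, sub_eq_iff_eq_add]
          conv_lhs => rw [← hyw]
          rw [smul_add]; abel
        have h3 : v i ∈ span ℝ {v j} ⊔ sp v (win n (j.val + 1) (m + 1)) := by
          rw [e]
          refine Submodule.smul_mem _ _ (add_mem (Submodule.mem_sup_left ?_)
            (Submodule.mem_sup_right hw))
          exact Submodule.smul_mem _ _ (mem_span_singleton_self _)
        rw [h1]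
        have := h2.1 h3
        omega
    · intro h
      have : v i = (v j + v i) - v j := by abel
      have goal := sub_mem (Submodule.mem_sup_left (mem_span_singleton_self _))
        (Submodule.mem_sup_right (S := span ℝ {v j + v i}) h)
      rwa [← this] at goal

theorem swv_fA_k (v : Fin n → V) {i j : Fin n} (hij : i < j) (hz : ∀ k, i < k → k < j → v k = 0)
    {k : Fin n} (hki : k ≠ i) (hkj : k ≠ j) : fA (swv v i j) k = fA v k := by
  have hij' : i.val < j.val := hij
  apply fA_congr
  intro m h1 h2
  rw [o_val, swv_ne v hkj]
  by_cases hk : i < k ∧ k < j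
  · rw [hz k hk.1 hk.2]
    exact iff_of_true (zero_mem _) (zero_mem _)
  · rw [swv_sp v hij.ne]
    intro hj
    rw [mem_win] at hj ⊢
    obtain ⟨t, h3, h4, h5⟩ := hj
    have h6 := o_eq_val h5
    have hki' : k.val ≠ i.val := fun h => hki (Fin.ext h)
    have hkj' : k.val ≠ j.val := fun h => hkj (Fin.ext h)
    rw [Fin.lt_def, Fin.lt_def] at hk
    refine ⟨t - (j.val - i.val), ?_, by omega, ?_⟩
    · have hkn := k.2
      have hjn := j.2
      by_cases htn : t < n
      · rw [Nat.mod_eq_of_lt htn] at h6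
        omega
      · have : t % n = t - n := by
          rw [Nat.mod_eq_sub_mod (by omega), Nat.mod_eq_of_lt (by omega)]
        omega
    · refine Eq.trans ?_ (o_val i)
      rw [o_eq_iff]
      have h7 : t ≡ j.val [MOD n] := by rw [← o_eq_iff, h5, o_val]
      apply Nat.ModEq.add_right_cancel' (j.val - i.val)
      have h8 : j.val ≤ t := by rw [← h6]; exact Nat.mod_le _ _
      rw [show t - (j.val - i.val) + (j.val - i.val) = t by omega,
        show i.val + (j.val - i.val) = j.val by omega]
      exact h7

end Swap

section SwapM
variable {n : ℕ} [NeZero n] {d : ℕ}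

/-- bridge on matrices -/
def swA (A : Matrix (Fin d) (Fin n) ℝ) (i j : Fin n) : Matrix (Fin d) (Fin n) ℝ :=
  A.updateCol j (fun r => A r j + A r i)

theorem cv_swA (A : Matrix (Fin d) (Fin n) ℝ) (i j : Fin n) : cv (swA A i j) = swv (cv A) i j := by
  funext k
  ext r
  by_cases h : k = j
  · subst h
    simp [cv, swA, swv_self]
  · rw [swv_ne _ h]
    simp [cv, swA, h]

theorem swA_minor (A : Matrix (Fin d) (Fin n) ℝ) {i j : Fin n} (hij : i < j)
    (hz : ∀ k, i < k → k < j → cv A k = 0)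
    (hA : ∀ f : Fin d → Fin n, StrictMono f → 0 ≤ (A.submatrix id f).det)
    (f : Fin d → Fin n) (hf : StrictMono f) : 0 ≤ ((swA A i j).submatrix id f).det := by
  by_cases hex : ∃ p, f p = j
  · obtain ⟨p, hp⟩ := hex
    have e1 : (swA A i j).submatrix id f = (A.submatrix id f).updateCol p
        ((fun r => A r j) + (fun r => A r i)) := by
      ext r q
      by_cases hq : q = p
      · subst hq; simp [swA, hp]
      · have : f q ≠ j := fun h => hq (hf.injective (h.trans hp.symm))
        simp [swA, hq, this]
    have e2 : (A.submatrix id f).updateCol p (fun r => A r j) = A.submatrix id f := by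
      ext r q
      by_cases hq : q = p
      · subst hq; simp [hp]
      · simp [hq]
    have e3 : (A.submatrix id f).updateCol p (fun r => A r i) =
        A.submatrix id (Function.update f p i) := by
      ext r q
      by_cases hq : q = p
      · subst hq; simp
      · simp [hq]
    rw [e1, Matrix.det_updateCol_add, e2, e3]
    apply add_nonneg (hA f hf)
    by_cases hbad : ∃ q, q < p ∧ i ≤ f q
    · obtain ⟨q, hq, hqi⟩ := hbad
      rcases hqi.eq_or_lt with h | h
      · rw [Matrix.det_zero_of_column_eq (ne_of_lt hq)]
        intro r
        simp [hq.ne, h]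
      · rw [Matrix.det_eq_zero_of_column_eq_zero q]
        intro r
        have := hz (f q) h (by rw [← hp]; exact hf hq)
        have h2 := congrFun this r
        simpa [hq.ne, cv] using h2
    · push Not at hbad
      apply hA
      intro a b hab
      by_cases ha : a = p
      · subst ha
        have hb : b ≠ a := hab.ne'
        rw [Function.update_self, Function.update_of_ne hb]
        exact hij.trans (hp ▸ hf hab)
      · rw [Function.update_of_ne ha]
        by_cases hb : b = p
        · subst hb
          rw [Function.update_self]
          exact hbad a hab
        · rw [Function.update_of_ne hb]
          exact hf hab
  · push Not at hex
    have e1 : (swA A i j).submatrix id f = A.submatrix id f := by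
      ext r q
      simp [swA, hex q]
    rw [e1]; exact hA f hf

theorem swA_fA {A : Matrix (Fin d) (Fin n) ℝ} {i j : Fin n} (hij : i < j)
    (hz : ∀ k, i < k → k < j → cv A k = 0)
    (hbc : fA (cv A) j < fA (cv A) i) (hc : fA (cv A) i ≤ i.val + n) (k : Fin n) :
    fA (cv (swA A i j)) k = fA (cv A) (Equiv.swap i j k) := by
  rw [cv_swA]
  by_cases h1 : k = i
  · subst h1
    rw [Equiv.swap_apply_left]
    exact swv_fA_i _ hij hz (le_fA _ _) hbc hc
  · by_cases h2 : k = j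
    · subst h2
      rw [Equiv.swap_apply_right]
      exact swv_fA_j _ hij hz (le_fA _ _) hbc hc
    · rw [Equiv.swap_apply_of_ne_of_ne h1 h2]
      exact swv_fA_k _ hij hz h1 h2

theorem swA_tnn {A : Matrix (Fin d) (Fin n) ℝ} (hA : A.TotallyNonneg) {i j : Fin n} (hij : i < j)
    (hz : ∀ k, i < k → k < j → cv A k = 0)
    (hbc : fA (cv A) j < fA (cv A) i) (hc : fA (cv A) i ≤ i.val + n) :
    (swA A i j).TotallyNonneg := by
  refine ⟨?_, swA_minor A hij hz hA.2⟩
  have h := hA.1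
  rw [rank_eq_count] at h ⊢
  refine Eq.trans ?_ h
  apply Finset.card_bij (fun k _ => Equiv.swap i j k)
  · intro a ha
    simp only [Finset.mem_filter, Finset.mem_univ, true_and, swA_fA hij hz hbc hc] at ha ⊢
    exact ha
  · intro a _ b _ hab
    exact (Equiv.swap i j).injective hab
  · intro b hb
    refine ⟨Equiv.swap i j b, ?_, by simp⟩
    simp only [Finset.mem_filter, Finset.mem_univ, true_and, swA_fA hij hz hbc hc,
      Equiv.swap_apply_self] at hb ⊢
    exact hb

end SwapM

end Posi

open Finset

namespace Posi
open Submodule Module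

set_option linter.unusedSectionVars false

section Surj
variable {n : ℕ} [NeZero n]

/-- bounded affine permutations -/
def IsBAP (f : Fin n → ℕ) : Prop :=
  (∀ i, i.val ≤ f i ∧ f i ≤ i.val + n) ∧ ∀ i j, f i % n = f j % n → i = j

theorem cv_zero_of_loop {d : ℕ} {A : Matrix (Fin d) (Fin n) ℝ} {k : Fin n}
    (h : fA (cv A) k.val = k.val) : cv A k = 0 := by
  have h1 := (fA_spec (cv A) (i := k.val) le_rfl).2 h.le
  rw [win_self, o_val] at h1
  simpa [sp] using h1

theorem sum_swap_lt (f : Fin n → ℕ) {i j : Fin n} (hij : i < j) (hf : f i < f j) :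
    ∑ k : Fin n, (k.val + 1) * f (Equiv.swap i j k) < ∑ k : Fin n, (k.val + 1) * f k := by
  have hji : j ∈ Finset.univ.erase i := by simp [hij.ne']
  rw [← Finset.add_sum_erase _ _ (Finset.mem_univ i), ← Finset.add_sum_erase _ _ hji,
    ← Finset.add_sum_erase (a := i) _ (fun k : Fin n => (k.val + 1) * f k) (Finset.mem_univ i),
    ← Finset.add_sum_erase _ (fun k : Fin n => (k.val + 1) * f k) hji]
  have e : ∑ k ∈ (Finset.univ.erase i).erase j, (k.val + 1) * f (Equiv.swap i j k) =
      ∑ k ∈ (Finset.univ.erase i).erase j, (k.val + 1) * f k := by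
    apply Finset.sum_congr rfl
    intro k hk
    simp only [Finset.mem_erase, Finset.mem_univ, and_true] at hk
    rw [Equiv.swap_apply_of_ne_of_ne hk.2 hk.1]
  rw [e, Equiv.swap_apply_left, Equiv.swap_apply_right]
  have hij' : i.val < j.val := hij
  nlinarith

theorem exists_desc {f : Fin n → ℕ} (hf : IsBAP f) (hnc : ∀ k, f k ≠ k.val + n)
    (hnl : ∃ k, f k ≠ k.val) : ∃ i j : Fin n, i < j ∧ f i ≠ i.val ∧ f j ≠ j.val ∧ f i < f j := by
  set N := Finset.univ.filter (fun k : Fin n => f k ≠ k.val) with hN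
  have hne : N.Nonempty := by
    obtain ⟨k, hk⟩ := hnl
    exact ⟨k, by simp [hN, hk]⟩
  have hn := Nat.pos_of_ne_zero (NeZero.ne n)
  have hi := Finset.min'_mem N hne
  have hj := Finset.max'_mem N hne
  set i := N.min' hne with hidef
  set j := N.max' hne with hjdef
  have hi' : f i ≠ i.val := by simpa [hN] using hi
  have hj' : f j ≠ j.val := by simpa [hN] using hj
  have b1 := (hf.1 i).2
  have b2 := hnc i
  have b3 := (hf.1 j).1
  have b4 := (hf.1 j).2
  have b5 := hnc j
  have hmod := Nat.mod_lt (f j) hn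
  have hxN : (⟨f j % n, hmod⟩ : Fin n) ∈ N := by
    by_contra h
    have h1 : f ⟨f j % n, hmod⟩ = f j % n := by
      simpa [hN] using h
    have h2 := hf.2 ⟨f j % n, hmod⟩ j (by rw [h1, Nat.mod_mod])
    rw [h2] at h
    exact h hj
  have h1 : (⟨f j % n, hmod⟩ : Fin n) ≤ j := Finset.le_max' N _ hxN
  have h2 : i ≤ (⟨f j % n, hmod⟩ : Fin n) := Finset.min'_le N _ hxN
  rw [Fin.le_def] at h1 h2
  simp only at h1 h2
  have hjn := j.2
  have h3 : i.val + n ≤ f j := by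
    by_cases h : f j < n
    · rw [Nat.mod_eq_of_lt h] at h1
      omega
    · rw [Nat.mod_eq_sub_mod (by omega), Nat.mod_eq_of_lt (by omega)] at h2
      omega
  have h4 : i ≤ j := Finset.min'_le_max' N hne
  refine ⟨i, j, lt_of_le_of_ne h4 ?_, hi', hj', by omega⟩
  intro h
  rw [h] at h3 b1 b2
  omega

theorem exists_desc_min {f : Fin n → ℕ} (hf : IsBAP f) (hnc : ∀ k, f k ≠ k.val + n)
    (hnl : ∃ k, f k ≠ k.val) : ∃ i j : Fin n, i < j ∧ f i < f j ∧ (∀ k, i < k → k < j → f k = k.val) ∧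
      j.val ≤ f i ∧ f j ≤ i.val + n := by
  classical
  obtain ⟨i0, j0, h0⟩ := exists_desc hf hnc hnl
  have hex : ∃ D, ∃ i j : Fin n, (i < j ∧ f i ≠ i.val ∧ f j ≠ j.val ∧ f i < f j) ∧
      j.val - i.val = D := ⟨_, i0, j0, h0, rfl⟩
  obtain ⟨i, j, ⟨hij, hi, hj, hlt⟩, hD⟩ := Nat.find_spec hex
  have hmin := fun m hm => Nat.find_min hex (m := m) hm
  rw [← hD] at hmin
  have hij' : i.val < j.val := hij
  have hloop : ∀ k, i < k → k < j → f k = k.val := by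
    intro k hik hkj
    by_contra hk
    have hik' : i.val < k.val := hik
    have hkj' : k.val < j.val := hkj
    by_cases h : f i < f k
    · exact hmin (k.val - i.val) (by omega) ⟨i, k, ⟨hik, hi, hk, h⟩, rfl⟩
    · exact hmin (j.val - k.val) (by omega) ⟨k, j, ⟨hkj, hk, hj, by omega⟩, rfl⟩
  refine ⟨i, j, hij, hlt, hloop, ?_, ?_⟩
  · by_contra hcon
    have h1 := (hf.1 i).1
    have h2 : f i < n := by have := j.2; omega
    have h3 := hloop ⟨f i, h2⟩ (by rw [Fin.lt_def]; simp only; omega)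
      (by rw [Fin.lt_def]; simp only; omega)
    have h4 := hf.2 ⟨f i, h2⟩ i (by rw [h3])
    exact hi (congrArg Fin.val h4)
  · by_contra hcon
    have h1 := (hf.1 j).2
    have h5 := hnc j
    have h2 : f j - n < n := by have := j.2; omega
    have h3 := hloop ⟨f j - n, h2⟩ (by rw [Fin.lt_def]; simp only; omega)
      (by rw [Fin.lt_def]; simp only; omega)
    have h4 := hf.2 ⟨f j - n, h2⟩ j (by
      rw [h3]; simp only
      rw [← Nat.mod_eq_sub_mod (by omega)])
    have := congrArg Fin.val h4
    simp only at this
    omega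

theorem exists_tnn_aux (N : ℕ) : ∀ f : Fin n → ℕ, IsBAP f → ∑ k : Fin n, (k.val + 1) * f k = N →
    ∃ (d : ℕ) (A : Matrix (Fin d) (Fin n) ℝ), A.TotallyNonneg ∧ ∀ i : Fin n, fA (cv A) i.val = f i := by
  classical
  have hn := Nat.pos_of_ne_zero (NeZero.ne n)
  induction N using Nat.strong_induction_on with
  | _ N ih =>
    intro f hf hN
    by_cases hco : ∃ k, f k = k.val + n
    · obtain ⟨k, hk⟩ := hco
      set g := Function.update f k k.val with hg
      have hgk : g k = k.val := by simp [hg]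
      have hgne : ∀ j, j ≠ k → g j = f j := fun j hj => by simp [hg, hj]
      have hgBAP : IsBAP g := by
        constructor
        · intro i
          by_cases hi : i = k
          · subst hi; rw [hgk]; omega
          · rw [hgne i hi]; exact hf.1 i
        · have hm : ∀ i, g i % n = f i % n := by
            intro i
            by_cases hi : i = k
            · subst hi; rw [hgk, hk, Nat.add_mod_right]
            · rw [hgne i hi]
          intro i j h
          rw [hm, hm] at h
          exact hf.2 i j h
      have hlt : ∑ j : Fin n, (j.val + 1) * g j < N := by
        rw [← hN]
        apply Finset.sum_lt_sum
        · intro j _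
          by_cases hj : j = k
          · subst hj; rw [hgk, hk]; exact Nat.mul_le_mul_left _ (by omega)
          · rw [hgne j hj]
        · refine ⟨k, Finset.mem_univ _, ?_⟩
          rw [hgk, hk]
          exact Nat.mul_lt_mul_of_pos_left (by omega) (by omega)
      obtain ⟨d, A, hA, hfA⟩ := ih _ hlt g hgBAP rfl
      have hz : ∀ r, A r k = 0 := by
        intro r
        exact congrFun (cv_zero_of_loop (A := A) (k := k) (by rw [hfA, hgk])) r
      refine ⟨d + 1, colA A k, colA_tnn hA hz, fun i => ?_⟩
      rw [colA_fA A hz]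
      split_ifs with h
      · rw [h, hk]
      · rw [hfA, hgne i h]
    · push Not at hco
      by_cases hl : ∃ k, f k ≠ k.val
      · obtain ⟨i, j, hij, hlt, hloop, hji, hjn⟩ := exists_desc_min hf hco hl
        have hij' : i.val < j.val := hij
        obtain ⟨d, A, hA, hfA⟩ := ih _ (hN ▸ sum_swap_lt f hij hlt) (fun k => f (Equiv.swap i j k)) (by
          constructor
          · intro k
            beta_reduce
            by_cases h1 : k = i
            · subst h1; rw [Equiv.swap_apply_left]; omega
            · by_cases h2 : k = j
              · subst h2; rw [Equiv.swap_apply_right]; omega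
              · rw [Equiv.swap_apply_of_ne_of_ne h1 h2]; exact hf.1 k
          · intro a b h
            exact (Equiv.swap i j).injective (hf.2 _ _ h)) rfl
        have hz : ∀ k, i < k → k < j → cv A k = 0 := by
          intro k h1 h2
          apply cv_zero_of_loop
          rw [hfA, Equiv.swap_apply_of_ne_of_ne h1.ne' h2.ne]
          exact hloop k h1 h2
        have hbc : fA (cv A) j < fA (cv A) i := by
          rw [hfA, hfA, Equiv.swap_apply_left, Equiv.swap_apply_right]; exact hlt
        have hc : fA (cv A) i ≤ i.val + n := by
          rw [hfA, Equiv.swap_apply_left]; exact hjn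
        refine ⟨d, swA A i j, swA_tnn hA hij hz hbc hc, fun k => ?_⟩
        rw [swA_fA hij hz hbc hc, hfA, Equiv.swap_apply_self]
      · push Not at hl
        have hfl : ∀ i : Fin n, fA (cv (0 : Matrix (Fin 0) (Fin n) ℝ)) i.val = f i := by
          intro i
          rw [hl]
          apply fA_eq_of' _ le_rfl (by omega)
          intro m hm _
          refine iff_of_true ?_ hm
          have : cv (0 : Matrix (Fin 0) (Fin n) ℝ) (o n i.val) = 0 := by
            ext r; exact r.elim0
          rw [this]; exact zero_mem _
        refine ⟨0, 0, ⟨?_, ?_⟩, hfl⟩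
        · simp
        · intro g _
          rw [Matrix.det_fin_zero]; exact zero_le_one

theorem exists_tnn {f : Fin n → ℕ} (hf : IsBAP f) :
    ∃ (d : ℕ) (A : Matrix (Fin d) (Fin n) ℝ), A.TotallyNonneg ∧ ∀ i : Fin n, fA (cv A) i.val = f i :=
  exists_tnn_aux _ f hf rfl

theorem isBAP_fA {V : Type*} [AddCommGroup V] [Module ℝ V] (v : Fin n → V) :
    IsBAP (fun i : Fin n => fA v i.val) :=
  ⟨fun i => ⟨le_fA v _, fA_le v _⟩, fun i j h => Fin.ext (fA_mod_inj v i.2 j.2 h)⟩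

end Surj

end Posi

open Finset

namespace Posi
open Submodule Module

set_option linter.unusedSectionVars false
set_option linter.unusedVariables false

section Corr
variable {n : ℕ} [NeZero n]

theorem rk_le_of_li {V V' : Type*} [AddCommGroup V] [Module ℝ V] [AddCommGroup V'] [Module ℝ V']
    {v : Fin n → V} {v' : Fin n → V'}
    (h : ∀ S : Finset (Fin n), LinearIndepOn ℝ v (S : Set (Fin n)) → LinearIndepOn ℝ v' (S : Set (Fin n)))
    (W : Finset (Fin n)) : rk v W ≤ rk v' W := by
  obtain ⟨B, hBW, hB, hsp⟩ := exists_basis v W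
  have h1 : rk v W = B.card := by rw [← (li_iff v B).1 hB]; unfold rk; rw [hsp]
  rw [h1, ← (li_iff v' B).1 (h B hB)]
  exact rk_mono v' hBW

theorem fA_eq_of_rk {V V' : Type*} [AddCommGroup V] [Module ℝ V] [AddCommGroup V'] [Module ℝ V']
    {v : Fin n → V} {v' : Fin n → V'} (h : ∀ W, rk v W = rk v' W) (i : ℕ) : fA v i = fA v' i := by
  have key : ∀ (x : Fin n) (W : Finset (Fin n)), v x ∈ sp v W ↔ v' x ∈ sp v' W := by
    intro x W
    have h1 := h W
    have h2 := h (insert x W)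
    constructor
    · intro hx
      by_contra hx'
      rw [rk_insert_of_mem v hx, rk_insert_of_notMem v' hx'] at h2
      omega
    · intro hx
      by_contra hx'
      rw [rk_insert_of_notMem v hx', rk_insert_of_mem v' hx] at h2
      omega
  apply fA_congr
  intro m _ _
  exact key _ _

theorem exists_full_basis {d : ℕ} {A : Matrix (Fin d) (Fin n) ℝ} (hA : A.TotallyNonneg)
    {S : Finset (Fin n)} (hS : LinearIndepOn ℝ (cv A) (S : Set (Fin n))) :
    ∃ B, S ⊆ B ∧ B.card = d ∧ LinearIndepOn ℝ (cv A) (B : Set (Fin n)) := by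
  obtain ⟨B, h1, -, h3, h4⟩ := exists_ext (cv A) hS (Finset.subset_univ S)
  refine ⟨B, h1, ?_, h3⟩
  have e1 := (li_iff _ B).1 h3
  have e2 := rk_univ hA
  unfold rk at e1 e2
  rw [h4] at e1
  omega

/-- `A` represents `ℬ` -/
def RepB {d : ℕ} (A : Matrix (Fin d) (Fin n) ℝ) (ℬ : Finset (Finset (Fin n))) : Prop :=
  A.TotallyNonneg ∧ ∀ B, B ∈ ℬ ↔ B.card = d ∧ LinearIndepOn ℝ (cv A) (B : Set (Fin n))

theorem isPositroid_iff (ℬ : Finset (Finset (Fin n))) :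
    IsPositroid (fun B => B ∈ ℬ) ↔ ∃ (d : ℕ) (A : Matrix (Fin d) (Fin n) ℝ), RepB A ℬ := by
  rfl

theorem fA_of_bases {d d' : ℕ} {A : Matrix (Fin d) (Fin n) ℝ} {A' : Matrix (Fin d') (Fin n) ℝ}
    {ℬ : Finset (Finset (Fin n))} (h : RepB A ℬ) (h' : RepB A' ℬ) (i : ℕ) :
    fA (cv A) i = fA (cv A') i := by
  have key : ∀ {d d' : ℕ} {A : Matrix (Fin d) (Fin n) ℝ} {A' : Matrix (Fin d') (Fin n) ℝ},
      RepB A ℬ → RepB A' ℬ → ∀ S : Finset (Fin n), LinearIndepOn ℝ (cv A) (S : Set (Fin n)) →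
      LinearIndepOn ℝ (cv A') (S : Set (Fin n)) := by
    intro d d' A A' h h' S hS
    obtain ⟨B, h1, h2, h3⟩ := exists_full_basis h.1 hS
    have h4 := (h.2 B).2 ⟨h2, h3⟩
    exact ((h'.2 B).1 h4).2.mono (by exact_mod_cast h1)
  apply fA_eq_of_rk
  intro W
  exact le_antisymm (rk_le_of_li (key h h') W) (rk_le_of_li (key h' h) W)

/-- relation between basis collections and bounded affine permutations -/
def Rel (ℬ : Finset (Finset (Fin n))) (f : Fin n → ℕ) : Prop :=
  ∃ (d : ℕ) (A : Matrix (Fin d) (Fin n) ℝ), RepB A ℬ ∧ ∀ i : Fin n, fA (cv A) i.val = f i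

theorem Rel.unique_right {ℬ : Finset (Finset (Fin n))} {f f' : Fin n → ℕ} (h : Rel ℬ f)
    (h' : Rel ℬ f') : f = f' := by
  obtain ⟨d, A, h1, h2⟩ := h
  obtain ⟨d', A', h3, h4⟩ := h'
  funext i
  rw [← h2, ← h4]
  exact fA_of_bases h1 h3 _

theorem Rel.unique_left {ℬ ℬ' : Finset (Finset (Fin n))} {f : Fin n → ℕ} (h : Rel ℬ f)
    (h' : Rel ℬ' f) : ℬ = ℬ' := by
  obtain ⟨d, A, h1, h2⟩ := h
  obtain ⟨d', A', h3, h4⟩ := h'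
  obtain ⟨e1, e2⟩ := bases_eq h1.1 h3.1 (fun i hi => by
    have a := h2 ⟨i, hi⟩
    have b := h4 ⟨i, hi⟩
    simp only at a b
    rw [a, b])
  ext B
  rw [h1.2, h3.2]
  constructor
  · rintro ⟨h5, h6⟩
    exact ⟨h5.trans e1, (e2 B h5).1 h6⟩
  · rintro ⟨h5, h6⟩
    have h7 := h5.trans e1.symm
    exact ⟨h7, (e2 B h7).2 h6⟩

theorem Rel.bap {ℬ : Finset (Finset (Fin n))} {f : Fin n → ℕ} (h : Rel ℬ f) : IsBAP f := by
  obtain ⟨d, A, h1, h2⟩ := h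
  have := isBAP_fA (cv A)
  simp only [h2] at this
  exact this

theorem exists_rel_right {ℬ : Finset (Finset (Fin n))} (h : IsPositroid (fun B => B ∈ ℬ)) :
    ∃ f, Rel ℬ f := by
  obtain ⟨d, A, hA⟩ := (isPositroid_iff ℬ).1 h
  exact ⟨_, d, A, hA, fun i => rfl⟩

theorem exists_rel_left {f : Fin n → ℕ} (h : IsBAP f) : ∃ ℬ, Rel ℬ f := by
  classical
  obtain ⟨d, A, hA, hf⟩ := exists_tnn h
  refine ⟨Finset.univ.filter (fun B => B.card = d ∧ LinearIndepOn ℝ (cv A) (B : Set (Fin n))),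
    d, A, ⟨hA, ?_⟩, hf⟩
  intro B
  simp

theorem Rel.pos {ℬ : Finset (Finset (Fin n))} {f : Fin n → ℕ} (h : Rel ℬ f) :
    IsPositroid (fun B => B ∈ ℬ) := by
  obtain ⟨d, A, h1, h2⟩ := h
  exact (isPositroid_iff ℬ).2 ⟨d, A, h1⟩

/-- decode a decorated permutation -/
def dec (S : Finset (Fin n)) (π : Equiv.Perm (Fin n)) (i : Fin n) : ℕ :=
  if i ∈ S then i.val else if i < π i then (π i).val else (π i).val + n

theorem dec_mod {S : Finset (Fin n)} {π : Equiv.Perm (Fin n)} (h : ∀ i ∈ S, π i = i) (i : Fin n) :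
    dec S π i % n = (π i).val := by
  unfold dec
  split_ifs with h1 h2
  · rw [h i h1, Nat.mod_eq_of_lt i.2]
  · rw [Nat.mod_eq_of_lt (π i).2]
  · rw [Nat.add_mod_right, Nat.mod_eq_of_lt (π i).2]

theorem dec_bap {S : Finset (Fin n)} {π : Equiv.Perm (Fin n)} (h : ∀ i ∈ S, π i = i) :
    IsBAP (dec S π) := by
  constructor
  · intro i
    unfold dec
    have h1 := i.2
    have h2 := (π i).2
    split_ifs with h3 h4
    · omega
    · rw [Fin.lt_def] at h4; omega
    · rw [Fin.lt_def] at h4; omega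
  · intro i j hij
    rw [dec_mod h, dec_mod h] at hij
    exact π.injective (Fin.ext hij)

theorem dec_eq_self {S : Finset (Fin n)} {π : Equiv.Perm (Fin n)} (i : Fin n) :
    dec S π i = i.val ↔ i ∈ S := by
  unfold dec
  have h1 := i.2
  have h2 := (π i).2
  split_ifs with h3 h4
  · simp [h3]
  · rw [Fin.lt_def] at h4
    simp only [h3, iff_false]; omega
  · simp only [h3, iff_false]; omega

/-- permutation of a bounded affine permutation -/
noncomputable def permOf {f : Fin n → ℕ} (hf : IsBAP f) : Equiv.Perm (Fin n) :=
  Equiv.ofBijective (fun i => ⟨f i % n, Nat.mod_lt _ (Nat.pos_of_ne_zero (NeZero.ne n))⟩)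
    (Finite.injective_iff_bijective.1 (fun i j h => hf.2 i j (congrArg Fin.val h)))

theorem permOf_val {f : Fin n → ℕ} (hf : IsBAP f) (i : Fin n) : (permOf hf i).val = f i % n := rfl

theorem bap_cases {f : Fin n → ℕ} (hf : IsBAP f) (i : Fin n) :
    (f i < n ∧ f i % n = f i) ∨ (n ≤ f i ∧ f i = f i % n + n) := by
  have h1 := (hf.1 i).2
  have h2 := i.2
  by_cases h : f i < n
  · exact Or.inl ⟨h, Nat.mod_eq_of_lt h⟩
  · right
    rw [Nat.mod_eq_sub_mod (by omega), Nat.mod_eq_of_lt (by omega)]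
    omega

theorem dec_permOf {f : Fin n → ℕ} (hf : IsBAP f) :
    dec (Finset.univ.filter (fun i : Fin n => f i = i.val)) (permOf hf) = f := by
  funext i
  unfold dec
  have h1 := hf.1 i
  have h2 := i.2
  have h3 := bap_cases hf i
  simp only [Finset.mem_filter, Finset.mem_univ, true_and, Fin.lt_def, permOf_val]
  split_ifs with h4 h5
  · exact h4.symm
  · omega
  · omega

theorem permOf_fix {f : Fin n → ℕ} (hf : IsBAP f) {i : Fin n} (h : f i = i.val) :
    permOf hf i = i := by
  apply Fin.ext
  rw [permOf_val, h, Nat.mod_eq_of_lt i.2]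

theorem permOf_eq_iff {f : Fin n → ℕ} (hf : IsBAP f) {i : Fin n} :
    permOf hf i = i ↔ f i = i.val ∨ f i = i.val + n := by
  rw [Fin.ext_iff, permOf_val]
  have h1 := hf.1 i
  have h2 := i.2
  have h3 := bap_cases hf i
  omega

/-- decorated permutations -/
noncomputable def posEquiv (n : ℕ) [NeZero n] :
    {p : Finset (Fin n) × Equiv.Perm (Fin n) // ∀ i ∈ p.1, p.2 i = i} ≃
    {ℬ : Finset (Finset (Fin n)) // IsPositroid (fun B => B ∈ ℬ)} :=
  Equiv.ofBijective
    (fun p => ⟨(exists_rel_left (dec_bap p.2)).choose,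
      (exists_rel_left (dec_bap p.2)).choose_spec.pos⟩) (by
    constructor
    · rintro ⟨⟨S, π⟩, hp⟩ ⟨⟨S', π'⟩, hp'⟩ h
      have h0 := congrArg Subtype.val h
      simp only at h0 hp hp'
      have e1 := (exists_rel_left (dec_bap hp)).choose_spec
      have e2 := (exists_rel_left (dec_bap hp')).choose_spec
      rw [h0] at e1
      have e3 := e1.unique_right e2
      have hS : S = S' := by
        ext i
        rw [← dec_eq_self (S := S) (π := π), ← dec_eq_self (S := S') (π := π'), e3]
      have hπ : π = π' := by
        ext i
        rw [← dec_mod hp, ← dec_mod hp', e3]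
      subst hS hπ
      rfl
    · rintro ⟨ℬ, hℬ⟩
      obtain ⟨f, hf⟩ := exists_rel_right hℬ
      have hb := hf.bap
      refine ⟨⟨⟨Finset.univ.filter (fun i : Fin n => f i = i.val), permOf hb⟩, ?_⟩, ?_⟩
      · intro i hi
        exact permOf_fix hb (by simpa using hi)
      · apply Subtype.ext
        simp only
        generalize_proofs h1
        have e1 := h1.choose_spec
        generalize h1.choose = X at e1
        rw [dec_permOf hb] at e1
        exact e1.unique_left hf)

theorem posEquiv_rel (p : {p : Finset (Fin n) × Equiv.Perm (Fin n) // ∀ i ∈ p.1, p.2 i = i}) :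
    Rel (posEquiv n p).1 (dec p.1.1 p.1.2) :=
  (exists_rel_left (dec_bap p.2)).choose_spec

theorem card_fix (S : Finset (Fin n)) :
    Fintype.card {π : Equiv.Perm (Fin n) // ∀ i ∈ S, π i = i} = (n - S.card).factorial := by
  have e := Equiv.Perm.subtypeEquivSubtypePerm (fun i : Fin n => i ∉ S)
  simp only [not_not] at e
  rw [← Fintype.card_congr e, Fintype.card_perm]
  congr 1
  rw [Fintype.card_subtype_compl]
  simp

theorem numPositroids_eq (n : ℕ) [NeZero n] :
    numPositroids n = ∑ k ∈ Finset.range (n + 1), n.choose k * (n - k).factorial := by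
  classical
  unfold numPositroids
  rw [← Nat.card_congr (posEquiv n)]
  let e : {p : Finset (Fin n) × Equiv.Perm (Fin n) // ∀ i ∈ p.1, p.2 i = i} ≃
      Σ S : Finset (Fin n), {π : Equiv.Perm (Fin n) // ∀ i ∈ S, π i = i} :=
    { toFun := fun p => ⟨p.1.1, ⟨p.1.2, p.2⟩⟩
      invFun := fun q => ⟨⟨q.1, q.2.1⟩, q.2.2⟩
      left_inv := fun p => rfl
      right_inv := fun q => rfl }
  rw [Nat.card_congr e, Nat.card_eq_fintype_card, Fintype.card_sigma]
  simp only [card_fix]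
  have := Finset.sum_powerset_apply_card (fun k => (n - k).factorial) (x := (Finset.univ : Finset (Fin n)))
  rw [Finset.powerset_univ, Finset.card_univ, Fintype.card_fin] at this
  rw [this]
  simp

theorem tendsto_numPositroids :
    Filter.Tendsto (fun n : ℕ => (numPositroids n : ℝ) / (n.factorial : ℝ)) Filter.atTop
      (nhds (Real.exp 1)) := by
  have h1 : Filter.Tendsto (fun n : ℕ => ∑ k ∈ Finset.range n, (1 : ℝ) / (k.factorial : ℝ))
      Filter.atTop (nhds (Real.exp 1)) := by
    have := (NormedSpace.expSeries_div_hasSum_exp (1 : ℝ)).tendsto_sum_nat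
    rw [← Real.exp_eq_exp_ℝ] at this
    simpa using this
  have h2 := (Filter.tendsto_add_atTop_iff_nat 1).2 h1
  refine h2.congr' ?_
  filter_upwards [Filter.eventually_ge_atTop 1] with n hn
  have : NeZero n := ⟨by omega⟩
  rw [numPositroids_eq, Nat.cast_sum, Finset.sum_div]
  apply Finset.sum_congr rfl
  intro k hk
  have hk' : k ≤ n := by have := Finset.mem_range.1 hk; omega
  have h3 := Nat.choose_mul_factorial_mul_factorial hk'
  have h4 : (n.factorial : ℝ) ≠ 0 := by exact_mod_cast n.factorial_ne_zero
  have h5 : (k.factorial : ℝ) ≠ 0 := by exact_mod_cast k.factorial_ne_zero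
  rw [div_eq_div_iff h5 h4, one_mul]
  have h6 : n.choose k * (n - k).factorial * k.factorial = n.factorial := by
    rw [← h3]; ring
  exact_mod_cast h6.symm

end Corr

end Posi

open Finset

namespace Posi
open Submodule Module

set_option linter.unusedSectionVars false
set_option linter.unusedVariables false

section Conn
variable {n : ℕ} [NeZero n] {d : ℕ} {A : Matrix (Fin d) (Fin n) ℝ} {ℬ : Finset (Finset (Fin n))}

theorem basis_exists (h : RepB A ℬ) : ∃ B, B ∈ ℬ := by
  obtain ⟨B, -, h2, h3⟩ := exists_full_basis h.1 (S := ∅) (by simp)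
  exact ⟨B, (h.2 B).2 ⟨h2, h3⟩⟩

theorem basis_exch (h : RepB A ℬ) {B₁ B₂ : Finset (Fin n)} (h1 : B₁ ∈ ℬ) (h2 : B₂ ∈ ℬ)
    {b : Fin n} (hb : b ∈ B₁ \ B₂) : ∃ c ∈ B₂ \ B₁, insert c (B₁.erase b) ∈ ℬ := by
  rw [Finset.mem_sdiff] at hb
  obtain ⟨c1, l1⟩ := (h.2 _).1 h1
  obtain ⟨c2, l2⟩ := (h.2 _).1 h2
  have le : LinearIndepOn ℝ (cv A) ((B₁.erase b : Finset _) : Set (Fin n)) :=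
    l1.mono (by exact_mod_cast Finset.erase_subset _ _)
  have hex : ∃ c ∈ B₂, cv A c ∉ sp (cv A) (B₁.erase b) := by
    by_contra hcon
    push Not at hcon
    have := rk_le_of_sp_le (cv A) (sp_le (cv A) hcon)
    rw [(li_iff _ _).1 l2, (li_iff _ _).1 le] at this
    have := Finset.card_erase_add_one hb.1
    omega
  obtain ⟨c, hc, hcn⟩ := hex
  have hc1 : c ∉ B₁.erase b := fun h => hcn (mem_sp _ h)
  have hcb : c ≠ b := by rintro rfl; exact hb.2 hc
  refine ⟨c, ?_, ?_⟩
  · rw [Finset.mem_sdiff]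
    exact ⟨hc, fun h => hc1 (Finset.mem_erase.2 ⟨hcb, h⟩)⟩
  · rw [h.2]
    refine ⟨?_, (li_insert _ hc1).2 ⟨le, hcn⟩⟩
    rw [Finset.card_insert_of_notMem hc1, Finset.card_erase_add_one hb.1, c1]

theorem isBasesSet_of_rep (h : RepB A ℬ) : IsBasesSet (fun B => B ∈ ℬ) :=
  ⟨basis_exists h, fun _ _ h1 h2 _ hb => basis_exch h h1 h2 hb⟩

theorem isBasesSet_singleton (X : Finset (Fin n)) : IsBasesSet (fun B => B = X) := by
  refine ⟨⟨X, rfl⟩, ?_⟩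
  rintro B₁ B₂ rfl rfl b hb
  simp at hb

theorem not_loop_of_conn (hn : 2 ≤ n) (h : RepB A ℬ) (hc : MatroidConnected (fun B => B ∈ ℬ))
    (i : Fin n) : fA (cv A) i.val ≠ i.val := by
  intro hi
  have hz := cv_zero_of_loop hi
  apply hc
  have hB : ∀ B ∈ ℬ, i ∉ B := by
    intro B hB hiB
    have h1 := ((h.2 B).1 hB).2
    exact h1.ne_zero (by exact_mod_cast hiB) hz
  refine ⟨{i}, Finset.univ.erase i, fun B => B = ∅, fun B => B ∈ ℬ, ⟨i, by simp⟩, ?_, ?_, ?_,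
    isBasesSet_singleton ∅, isBasesSet_of_rep h, ?_, ?_, ?_⟩
  · rw [← Finset.card_pos, Finset.card_erase_of_mem (Finset.mem_univ _), Finset.card_univ,
      Fintype.card_fin]
    omega
  · simp
  · rw [← Finset.insert_eq, Finset.insert_erase (Finset.mem_univ _)]
  · rintro B rfl; simp
  · intro B hB' x hx
    rw [Finset.mem_erase]
    refine ⟨?_, Finset.mem_univ _⟩
    rintro rfl; exact hB B hB' hx
  · intro B
    constructor
    · intro hB'
      exact ⟨∅, B, rfl, hB', by simp⟩
    · rintro ⟨B₁, B₂, rfl, h2, rfl⟩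
      simpa using h2

theorem not_coloop_of_conn (hn : 2 ≤ n) (h : RepB A ℬ) (hc : MatroidConnected (fun B => B ∈ ℬ))
    (i : Fin n) : fA (cv A) i.val ≠ i.val + n := by
  intro hi
  have hns : cv A i ∉ sp (cv A) (Finset.univ.erase i) := by
    have h1 := fA_spec (cv A) (i := i.val) (m := i.val + n - 1) (by omega)
    rw [o_val] at h1
    intro h2
    have : Finset.univ.erase i ⊆ win n (i.val + 1) (i.val + n - 1 + 1) := by
      intro x hx
      have hx' : x.val ≠ i.val := fun h => (Finset.mem_erase.1 hx).1 (Fin.ext h)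
      rw [mem_win]
      by_cases hlt : i.val < x.val
      · exact ⟨x.val, by omega, by have := x.2; omega, o_val x⟩
      · exact ⟨x.val + n, by have := i.2; omega, by omega, by rw [o_add, o_val]⟩
    have h3 := h1.1 (sp_mono _ this h2)
    omega
  apply hc
  have hB : ∀ B ∈ ℬ, i ∈ B := by
    intro B hB
    by_contra hiB
    obtain ⟨h1, h2⟩ := (h.2 B).1 hB
    have h3 : B ⊆ Finset.univ.erase i := by
      intro x hx
      rw [Finset.mem_erase]
      exact ⟨by rintro rfl; exact hiB hx, Finset.mem_univ _⟩
    have h4 : cv A i ∉ sp (cv A) B := fun h5 => hns (sp_mono _ h3 h5)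
    have h5 := rk_insert_of_notMem _ h4
    have h6 := rk_mono (cv A) (Finset.subset_univ (insert i B))
    rw [rk_univ h.1, h5, (li_iff _ _).1 h2] at h6
    omega
  refine ⟨{i}, Finset.univ.erase i, fun B => B = {i}, fun B => i ∉ B ∧ insert i B ∈ ℬ,
    ⟨i, by simp⟩, ?_, ?_, ?_,
    isBasesSet_singleton {i}, ?_, ?_, ?_, ?_⟩
  · rw [← Finset.card_pos, Finset.card_erase_of_mem (Finset.mem_univ _), Finset.card_univ,
      Fintype.card_fin]
    omega
  · simp
  · rw [← Finset.insert_eq, Finset.insert_erase (Finset.mem_univ _)]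
  · constructor
    · obtain ⟨B, hB'⟩ := basis_exists h
      exact ⟨B.erase i, by simp, by rwa [Finset.insert_erase (hB B hB')]⟩
    · rintro C₁ C₂ ⟨a1, a2⟩ ⟨a3, a4⟩ b hb
      rw [Finset.mem_sdiff] at hb
      have hbi : b ≠ i := by rintro rfl; exact a1 hb.1
      obtain ⟨c, hc1, hc2⟩ := basis_exch h a2 a4 (b := b) (by simp [hb.1, hb.2, hbi])
      simp only [Finset.mem_sdiff, Finset.mem_insert, not_or] at hc1
      have hc2C : c ∈ C₂ := hc1.1.resolve_left hc1.2.1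
      refine ⟨c, by rw [Finset.mem_sdiff]; exact ⟨hc2C, hc1.2.2⟩, ?_, ?_⟩
      · simp only [Finset.mem_insert, Finset.mem_erase, not_or]
        exact ⟨Ne.symm hc1.2.1, fun h => a1 h.2⟩
      · rw [Finset.erase_insert_of_ne hbi.symm] at hc2
        rwa [Finset.insert_comm]
  · rintro B rfl; simp
  · rintro B ⟨hB', -⟩ x hx
    rw [Finset.mem_erase]
    refine ⟨?_, Finset.mem_univ _⟩
    rintro rfl; exact hB' hx
  · intro B
    constructor
    · intro hB'
      refine ⟨{i}, B.erase i, rfl, ⟨by simp, by rwa [Finset.insert_erase (hB B hB')]⟩, ?_⟩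
      rw [← Finset.insert_eq, Finset.insert_erase (hB B hB')]
    · rintro ⟨B₁, B₂, rfl, ⟨_, h2⟩, rfl⟩
      show {i} ∪ B₂ ∈ ℬ
      rw [← Finset.insert_eq]; exact h2

/-- single exchange between two bases -/
def Chord (ℬ : Finset (Finset (Fin n))) (a c : Fin n) : Prop :=
  ∃ B ∈ ℬ, a ∈ B ∧ c ∉ B ∧ insert c (B.erase a) ∈ ℬ

theorem Chord.symm {a c : Fin n} (h : Chord ℬ a c) : Chord ℬ c a := by
  obtain ⟨B, h1, h2, h3, h4⟩ := h
  have hac : a ≠ c := by rintro rfl; exact h3 h2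
  refine ⟨_, h4, by simp, by simp [hac], ?_⟩
  rw [Finset.erase_insert (by simp [h3]), Finset.insert_erase h2]
  exact h1

theorem chord_fA (h : RepB A ℬ) {i : Fin n} (h1 : fA (cv A) i.val ≠ i.val)
    (h2 : fA (cv A) i.val ≠ i.val + n) : Chord ℬ i (o n (fA (cv A) i.val)) := by
  set v := cv A with hv
  set m := fA v i.val with hm
  have hle := le_fA v i.val
  have hle2 := fA_le v i.val
  set W := win n (i.val + 1) m with hW
  set q := o n m with hq
  have hiW : v i ∉ sp v W := by
    have := fA_spec v (i := i.val) (m := m - 1) (by omega)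
    rw [o_val, show m - 1 + 1 = m by omega] at this
    rw [this]; omega
  have hiq : v i ∈ sp v (insert q W) := by
    have := (fA_spec v (i := i.val) (m := m) (by omega)).2 le_rfl
    rw [o_val, win_succ_right (by omega)] at this
    exact this
  have hqi : v q ∈ sp v (insert i W) := by
    have := fA_last v i.val
    rw [← hm, win_succ_left (by omega), o_val] at this
    exact this
  have hqW : v q ∉ sp v W := by
    intro h3
    rw [sp_insert, sup_eq_right.2 (by rwa [span_singleton_le_iff_mem])] at hiq
    exact hiW hiq
  obtain ⟨S, hSW, hS, hSsp⟩ := exists_basis v W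
  have hiS : i ∉ S := fun h3 => hiW (hSsp ▸ mem_sp v h3)
  have hqS : q ∉ S := fun h3 => hqW (hSsp ▸ mem_sp v h3)
  have hqi' : q ≠ i := by
    intro h3
    have h4 := o_eq_val h3
    have := i.2
    by_cases h5 : m < n
    · rw [Nat.mod_eq_of_lt h5] at h4; omega
    · rw [Nat.mod_eq_sub_mod (by omega), Nat.mod_eq_of_lt (by omega)] at h4
      omega
  have hiS' : LinearIndepOn ℝ v ((insert i S : Finset _) : Set (Fin n)) :=
    (li_insert v hiS).2 ⟨hS, by rwa [hSsp]⟩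
  rw [sp_insert, ← hSsp, ← sp_insert] at hiq hqi
  obtain ⟨B, hB1, hB2, hB3⟩ := exists_full_basis h.1 hiS'
  have hiB : i ∈ B := hB1 (Finset.mem_insert_self _ _)
  have hqB : q ∉ B := by
    intro h3
    have h4 : LinearIndepOn ℝ v ((insert q (insert i S) : Finset _) : Set (Fin n)) :=
      hB3.mono (by exact_mod_cast Finset.insert_subset h3 hB1)
    exact ((li_insert v (by simp [hqi', hqS])).1 h4).2 hqi
  have hBe : LinearIndepOn ℝ v ((B.erase i : Finset _) : Set (Fin n)) :=
    hB3.mono (by exact_mod_cast Finset.erase_subset _ _)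
  have hSe : S ⊆ B.erase i := by
    intro x hx
    rw [Finset.mem_erase]
    exact ⟨by rintro rfl; exact hiS hx, hB1 (Finset.mem_insert_of_mem hx)⟩
  have hiBe : v i ∉ sp v (B.erase i) := by
    have h3 := hB3
    rw [← Finset.insert_erase hiB] at h3
    exact ((li_insert v (by simp)).1 h3).2
  have hqBe : q ∉ B.erase i := fun h3 => hqB (Finset.mem_of_mem_erase h3)
  refine ⟨B, (h.2 B).2 ⟨hB2, hB3⟩, hiB, hqB, (h.2 _).2 ⟨?_, (li_insert v hqBe).2 ⟨hBe, ?_⟩⟩⟩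
  · rw [Finset.card_insert_of_notMem hqBe, Finset.card_erase_add_one hiB, hB2]
  · intro h3
    apply hiBe
    rw [sp_insert] at hiq
    have h4 : span ℝ {v q} ⊔ sp v S ≤ sp v (B.erase i) :=
      sup_le (by rwa [span_singleton_le_iff_mem]) (sp_mono v hSe)
    exact h4 hiq

/-- a separation of the basis collection -/
structure Sep (ℬ : Finset (Finset (Fin n))) (E₁ : Finset (Fin n)) : Prop where
  ne1 : E₁.Nonempty
  ne2 : E₁ᶜ.Nonempty
  mix : ∀ B ∈ ℬ, ∀ C ∈ ℬ, (B ∩ E₁) ∪ (C ∩ E₁ᶜ) ∈ ℬ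

theorem Sep.symm {E₁ : Finset (Fin n)} (s : Sep ℬ E₁) : Sep ℬ E₁ᶜ :=
  ⟨s.ne2, by rw [compl_compl]; exact s.ne1, fun B hB C hC => by
    rw [compl_compl, Finset.union_comm]; exact s.mix C hC B hB⟩

theorem exists_sep (hc : ¬ MatroidConnected (fun B => B ∈ ℬ)) : ∃ E₁, Sep ℬ E₁ := by
  unfold MatroidConnected at hc
  rw [not_not] at hc
  obtain ⟨E₁, E₂, ℬ₁, ℬ₂, h1, h2, h3, h4, -, -, h5, h6, h7⟩ := hc
  have hE : E₁ᶜ = E₂ := by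
    ext x
    have a1 : x ∈ E₁ ∪ E₂ := h4 ▸ Finset.mem_univ x
    have a2 : x ∈ E₁ → x ∉ E₂ := fun h => Finset.disjoint_left.1 h3 h
    rw [Finset.mem_union] at a1
    rw [Finset.mem_compl]
    tauto
  refine ⟨E₁, h1, by rwa [hE], ?_⟩
  intro B hB C hC
  rw [hE]
  obtain ⟨B₁, B₂, b1, b2, rfl⟩ := (h7 B).1 hB
  obtain ⟨C₁, C₂, c1, c2, rfl⟩ := (h7 C).1 hC
  refine (h7 _).2 ⟨B₁, C₂, b1, c2, ?_⟩
  have d1 := h5 _ b1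
  have d2 := h6 _ b2
  have d3 := h5 _ c1
  have d4 := h6 _ c2
  ext x
  have e1 := @d1 x
  have e2 := @d2 x
  have e3 := @d3 x
  have e4 := @d4 x
  have a2 : x ∈ E₁ → x ∉ E₂ := fun h => Finset.disjoint_left.1 h3 h
  simp only [Finset.mem_union, Finset.mem_inter]
  tauto

theorem Sep.card_eq (h : RepB A ℬ) {E₁ : Finset (Fin n)} (s : Sep ℬ E₁) {B C : Finset (Fin n)}
    (hB : B ∈ ℬ) (hC : C ∈ ℬ) : (B ∩ E₁).card = (C ∩ E₁).card := by
  have h1 := ((h.2 _).1 (s.mix B hB C hC)).1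
  have h2 := ((h.2 _).1 hC).1
  have h3 : C = (C ∩ E₁) ∪ (C ∩ E₁ᶜ) := by
    ext x; simp only [Finset.mem_union, Finset.mem_inter, Finset.mem_compl]; tauto
  rw [h3] at h2
  have hd : ∀ X Y : Finset (Fin n), Disjoint (X ∩ E₁) (Y ∩ E₁ᶜ) := by
    intro X Y
    rw [Finset.disjoint_left]
    intro x
    simp only [Finset.mem_inter, Finset.mem_compl]
    tauto
  rw [Finset.card_union_of_disjoint (hd _ _)] at h1 h2
  omega

theorem Sep.colour (h : RepB A ℬ) {E₁ : Finset (Fin n)} (s : Sep ℬ E₁) {a c : Fin n}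
    (hac : Chord ℬ a c) (ha : a ∈ E₁) : c ∈ E₁ := by
  by_contra hc
  obtain ⟨B, h1, h2, h3, h4⟩ := hac
  have h5 := s.card_eq h h1 h4
  have h6 : insert c (B.erase a) ∩ E₁ = (B ∩ E₁).erase a := by
    ext x
    simp only [Finset.mem_inter, Finset.mem_insert, Finset.mem_erase]
    have : x = c → x ∉ E₁ := by rintro rfl; exact hc
    tauto
  rw [h6] at h5
  have := Finset.card_erase_add_one (Finset.mem_inter.2 ⟨h2, ha⟩)
  omega

theorem Sep.colour_iff (h : RepB A ℬ) {E₁ : Finset (Fin n)} (s : Sep ℬ E₁) {a c : Fin n}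
    (hac : Chord ℬ a c) : a ∈ E₁ ↔ c ∈ E₁ :=
  ⟨s.colour h hac, s.colour h hac.symm⟩

set_option maxHeartbeats 1600000 in
theorem Sep.noncross (h : RepB A ℬ) {E₁ : Finset (Fin n)} (s : Sep ℬ E₁) {a c x y : Fin n}
    (hac : Chord ℬ a c) (hxy : Chord ℬ x y) (ha : a ∈ E₁) (hx : x ∉ E₁) :
    ¬(((x < a ∧ a < y) ∨ (y < a ∧ a < x)) ∧ ((c < x ∧ c < y) ∨ (x < c ∧ y < c))) := by
  rintro ⟨p1, p2⟩
  have hc := s.colour h hac ha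
  have hy : y ∉ E₁ := fun h' => hx (s.colour h hxy.symm h')
  obtain ⟨B, b1, b2, b3, b4⟩ := hac
  obtain ⟨C, c1, c2, c3, c4⟩ := hxy
  set U := ((B ∩ E₁).erase a) ∪ ((C ∩ E₁ᶜ).erase x) with hU
  have key : ∀ z : Fin n, (z = a → z ∈ E₁ ∧ z ∈ B) ∧ (z = c → z ∈ E₁ ∧ z ∉ B) ∧
      (z = x → z ∉ E₁ ∧ z ∈ C) ∧ (z = y → z ∉ E₁ ∧ z ∉ C) := by
    intro z
    refine ⟨?_, ?_, ?_, ?_⟩ <;> rintro rfl <;> tauto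
  have haU : a ∉ U := by
    simp only [hU, Finset.mem_union, Finset.mem_erase, Finset.mem_inter, Finset.mem_compl]; tauto
  have hcU : c ∉ U := by
    simp only [hU, Finset.mem_union, Finset.mem_erase, Finset.mem_inter, Finset.mem_compl]; tauto
  have hxU : x ∉ U := by
    simp only [hU, Finset.mem_union, Finset.mem_erase, Finset.mem_inter, Finset.mem_compl]; tauto
  have hyU : y ∉ U := by
    simp only [hU, Finset.mem_union, Finset.mem_erase, Finset.mem_inter, Finset.mem_compl]; tauto
  have e1 : insert a (insert x U) = (B ∩ E₁) ∪ (C ∩ E₁ᶜ) := by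
    ext z
    have kz := key z
    simp only [hU, Finset.mem_union, Finset.mem_erase, Finset.mem_inter, Finset.mem_compl,
      Finset.mem_insert, ne_eq]
    clear_value U
    clear b1 b4 c1 c4 p1 p2 key
    grind
  have e2 : insert a (insert y U) = (B ∩ E₁) ∪ (insert y (C.erase x) ∩ E₁ᶜ) := by
    ext z
    have kz := key z
    simp only [hU, Finset.mem_union, Finset.mem_erase, Finset.mem_inter, Finset.mem_compl,
      Finset.mem_insert, ne_eq]
    clear_value U
    clear b1 b4 c1 c4 p1 p2 key
    grind
  have e3 : insert c (insert x U) = (insert c (B.erase a) ∩ E₁) ∪ (C ∩ E₁ᶜ) := by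
    ext z
    have kz := key z
    simp only [hU, Finset.mem_union, Finset.mem_erase, Finset.mem_inter, Finset.mem_compl,
      Finset.mem_insert, ne_eq]
    clear_value U
    clear b1 b4 c1 c4 p1 p2 key
    grind
  have e4 : insert c (insert y U) = (insert c (B.erase a) ∩ E₁) ∪ (insert y (C.erase x) ∩ E₁ᶜ) := by
    ext z
    have kz := key z
    simp only [hU, Finset.mem_union, Finset.mem_erase, Finset.mem_inter, Finset.mem_compl,
      Finset.mem_insert, ne_eq]
    clear_value U
    clear b1 b4 c1 c4 p1 p2 key
    grind
  have m1 := s.mix _ b1 _ c1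
  have m2 := s.mix _ b1 _ c4
  have m3 := s.mix _ b4 _ c1
  have m4 := s.mix _ b4 _ c4
  rw [← e1] at m1
  rw [← e2] at m2
  rw [← e3] at m3
  rw [← e4] at m4
  have hax : a ≠ x := by rintro rfl; exact hx ha
  have hac' : a ≠ c := by rintro rfl; exact b3 b2
  have hUc : U.card + 2 = d := by
    have := ((h.2 _).1 m1).1
    rw [Finset.card_insert_of_notMem (by simp [hax, haU]), Finset.card_insert_of_notMem hxU] at this
    omega
  have hfin := cross_symm h.1 hUc p1 p2 haU hcU hxU hyU ((h.2 _).1 m1).2 ((h.2 _).1 m2).2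
    ((h.2 _).1 m3).2 ((h.2 _).1 m4).2
  have m5 : insert a (insert c U) ∈ ℬ := by
    refine (h.2 _).2 ⟨?_, hfin⟩
    rw [Finset.card_insert_of_notMem (by simp [hac', haU]), Finset.card_insert_of_notMem hcU]
    omega
  have h5 := s.card_eq h m5 m1
  have h6 : insert a (insert c U) ∩ E₁ = insert c (insert a (insert x U) ∩ E₁) := by
    ext z
    have kz := key z
    clear_value U
    clear b1 b4 c1 c4 p1 p2 key m1 m2 m3 m4 m5 e1 e2 e3 e4 h5 hfin h
    simp only [Finset.mem_inter, Finset.mem_insert]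
    grind
  have h7 : c ∉ insert a (insert x U) ∩ E₁ := by
    have h71 : c ≠ x := by rintro rfl; exact hx hc
    simp only [Finset.mem_inter, Finset.mem_insert, not_and, not_or]
    intro h72
    rcases h72 with h72 | h72 | h72
    · exact absurd h72.symm hac'
    · exact absurd h72 h71
    · exact absurd h72 hcU
  rw [h6, Finset.card_insert_of_notMem h7] at h5
  omega

end Conn

end Posi

open Finset
namespace Posi

theorem eq_Icc_of_convex {n : ℕ} (I : Finset (Fin n)) (hne : I.Nonempty)
    (hcv : ∀ p ∈ I, ∀ q ∈ I, ∀ t, p ≤ t → t ≤ q → t ∈ I) :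
    ∃ a b : Fin n, a ≤ b ∧ I = Finset.Icc a b := by
  refine ⟨I.min' hne, I.max' hne, Finset.min'_le _ _ (Finset.max'_mem _ _), ?_⟩
  ext t
  rw [Finset.mem_Icc]
  constructor
  · intro ht
    exact ⟨Finset.min'_le _ _ ht, Finset.le_max' _ _ ht⟩
  · rintro ⟨h1, h2⟩
    exact hcv _ (Finset.min'_mem _ _) _ (Finset.max'_mem _ _) t h1 h2

theorem exists_stable {n : ℕ} (π : Equiv.Perm (Fin n)) (c : Fin n → Bool)
    (hc : ∀ i, c (π i) = c i) (hne : ∃ p q, c p ≠ c q)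
    (hnc : ∀ i j, c i ≠ c j → ¬(((j < i ∧ i < π j) ∨ (π j < i ∧ i < j)) ∧
      ((π i < j ∧ π i < π j) ∨ (j < π i ∧ π j < π i)))) :
    ∃ a b : Fin n, a ≤ b ∧ Finset.Icc a b ≠ Finset.univ ∧
      ∀ w ∈ Finset.Icc a b, π w ∈ Finset.Icc a b := by
  classical
  suffices H : ∃ I : Finset (Fin n), I.Nonempty ∧ I ≠ Finset.univ ∧
      (∀ p ∈ I, ∀ q ∈ I, ∀ t, p ≤ t → t ≤ q → t ∈ I) ∧ ∀ w ∈ I, π w ∈ I by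
    obtain ⟨I, h1, h2, h3, h4⟩ := H
    obtain ⟨a, b, hab, rfl⟩ := eq_Icc_of_convex I h1 h3
    exact ⟨a, b, hab, h2, h4⟩
  by_cases hA : ∃ k : ℕ, ∃ x y z : Fin n, x < z ∧ z < y ∧ (y = π x ∨ x = π y) ∧ c z ≠ c x ∧
      y.val - x.val = k
  · have hmin := fun k hk => Nat.find_min hA (m := k) hk
    obtain ⟨x, y, z, hxz, hzy, hch, hcz, hk⟩ := Nat.find_spec hA
    rw [← hk] at hmin
    clear hk hA
    have hcy : c y = c x := by
      rcases hch with rfl | rfl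
      · exact hc _
      · exact (hc _).symm
    refine ⟨Finset.univ.filter (fun w => x < w ∧ w < y ∧
      ∀ t, ((z ≤ t ∧ t ≤ w) ∨ (w ≤ t ∧ t ≤ z)) → c t = c z), ⟨z, ?_⟩, ?_, ?_, ?_⟩
    · simp only [Finset.mem_filter, Finset.mem_univ, true_and]
      refine ⟨hxz, hzy, fun t ht => ?_⟩
      have : t = z := by
        rcases ht with h | h
        · exact le_antisymm h.2 h.1
        · exact le_antisymm h.2 h.1
      rw [this]
    · intro h
      have := h ▸ Finset.mem_univ x
      simp at this
    · intro p hp q hq t h1 h2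
      simp only [Finset.mem_filter, Finset.mem_univ, true_and] at hp hq ⊢
      refine ⟨lt_of_lt_of_le hp.1 h1, lt_of_le_of_lt h2 hq.2.1, fun s hs => ?_⟩
      rcases hs with hs | hs
      · exact hq.2.2 s (Or.inl ⟨hs.1, hs.2.trans h2⟩)
      · exact hp.2.2 s (Or.inr ⟨h1.trans hs.1, hs.2⟩)
    · intro w hw
      simp only [Finset.mem_filter, Finset.mem_univ, true_and] at hw ⊢
      obtain ⟨w1, w2, w3⟩ := hw
      have hcw : c w = c z := w3 w (by
        rcases le_total z w with h | h
        · exact Or.inl ⟨h, le_rfl⟩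
        · exact Or.inr ⟨le_rfl, h⟩)
      have hcu : c (π w) = c z := (hc w).trans hcw
      have hux : π w ≠ x := by intro h; rw [h] at hcu; exact hcz hcu.symm
      have huy : π w ≠ y := by intro h; rw [h, hcy] at hcu; exact hcz hcu.symm
      have hin : x < π w ∧ π w < y := by
        have hxy : x < y := hxz.trans hzy
        rcases hch with h | h
        · have := hnc w x (by rw [hcw]; exact hcz)
          rw [← h] at this
          by_contra hcon
          apply this
          refine ⟨Or.inl ⟨w1, w2⟩, ?_⟩
          by_cases h5 : x < π w
          · have h6 : y < π w := lt_of_le_of_ne (not_lt.1 fun h => hcon ⟨h5, h⟩) huy.symm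
            exact Or.inr ⟨h5, h6⟩
          · have h6 : π w < x := lt_of_le_of_ne (not_lt.1 h5) hux
            exact Or.inl ⟨h6, h6.trans hxy⟩
        · have := hnc w y (by rw [hcw, hcy]; exact hcz)
          rw [← h] at this
          by_contra hcon
          apply this
          refine ⟨Or.inr ⟨w1, w2⟩, ?_⟩
          by_cases h5 : x < π w
          · have h6 : y < π w := lt_of_le_of_ne (not_lt.1 fun h => hcon ⟨h5, h⟩) huy.symm
            exact Or.inr ⟨h6, h5⟩
          · have h6 : π w < x := lt_of_le_of_ne (not_lt.1 h5) hux
            exact Or.inl ⟨h6.trans hxy, h6⟩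
      refine ⟨hin.1, hin.2, fun t ht => ?_⟩
      by_contra hct
      have htw : t ≠ w := by rintro rfl; exact hct hcw
      have htu : t ≠ π w := by intro h; rw [h] at hct; exact hct hcu
      have hbet : (w < t ∧ t < π w) ∨ (π w < t ∧ t < w) := by
        have h7 : ¬ ((z ≤ t ∧ t ≤ w) ∨ (w ≤ t ∧ t ≤ z)) := fun h => hct (w3 t h)
        have h8 : t.val ≠ w.val := fun h => htw (Fin.ext h)
        have h9 : t.val ≠ (π w).val := fun h => htu (Fin.ext h)
        clear hmin hnc w3 hc hch
        simp only [Fin.le_def, Fin.lt_def] at *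
        omega
      rcases hbet with hb | hb
      · refine hmin ((π w).val - w.val) ?_ ⟨w, π w, t, hb.1, hb.2, Or.inl rfl, ?_, rfl⟩
        · clear hmin hnc w3 hc hch ht; simp only [Fin.lt_def] at *; omega
        · rw [hcw]; exact hct
      · refine hmin (w.val - (π w).val) ?_ ⟨π w, w, t, hb.1, hb.2, Or.inr rfl, ?_, rfl⟩
        · clear hmin hnc w3 hc hch ht; simp only [Fin.lt_def] at *; omega
        · rw [hcu]; exact hct
  · obtain ⟨p, q, hpq⟩ := hne
    have hn : 0 < n := p.pos
    set z : Fin n := ⟨0, hn⟩ with hz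
    have hz0 : ∀ t, z ≤ t := fun t => Fin.le_def.2 (Nat.zero_le _)
    refine ⟨Finset.univ.filter (fun w => ∀ t, t ≤ w → c t = c z), ⟨z, ?_⟩, ?_, ?_, ?_⟩
    · simp only [Finset.mem_filter, Finset.mem_univ, true_and]
      intro t ht
      rw [le_antisymm ht (hz0 t)]
    · intro h
      have h1 : ∀ t, c t = c z := by
        intro t
        have := h ▸ Finset.mem_univ t
        simp only [Finset.mem_filter, Finset.mem_univ, true_and] at this
        exact this t le_rfl
      exact hpq ((h1 p).trans (h1 q).symm)
    · intro p hp q hq t h1 h2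
      simp only [Finset.mem_filter, Finset.mem_univ, true_and] at hp hq ⊢
      exact fun s hs => hq s (hs.trans h2)
    · intro w hw
      simp only [Finset.mem_filter, Finset.mem_univ, true_and] at hw ⊢
      intro t ht
      by_contra hct
      have hcw := hw w le_rfl
      have h1 : w < t := not_le.1 fun h => hct (hw t h)
      have h2 : t < π w := lt_of_le_of_ne ht (by
        intro h; rw [h, hc] at hct; exact hct hcw)
      exact hA ⟨_, w, π w, t, h1, h2, Or.inl rfl, by rw [hcw]; exact hct, rfl⟩

section
variable {n : ℕ} [NeZero n]

/-- a disconnected positroid with derangement `π` has a stable interval -/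
theorem stable_of_not_conn {ℬ : Finset (Finset (Fin n))} {π : Equiv.Perm (Fin n)}
    (hd : ∀ i, π i ≠ i) (hr : Rel ℬ (dec ∅ π))
    (hc : ¬ MatroidConnected (fun B => B ∈ ℬ)) :
    ∃ a b : Fin n, a ≤ b ∧ Finset.Icc a b ≠ Finset.univ ∧
      ∀ w ∈ Finset.Icc a b, π w ∈ Finset.Icc a b := by
  obtain ⟨E₁, s⟩ := exists_sep hc
  obtain ⟨d, A, hrep, hf⟩ := hr
  have hchord : ∀ i, Chord ℬ i (π i) := by
    intro i
    have h1 : fA (cv A) i.val ≠ i.val := by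
      rw [hf, Ne, dec_eq_self]; simp
    have h2 : fA (cv A) i.val ≠ i.val + n := by
      rw [hf]
      intro h
      have h3 := dec_mod (S := ∅) (π := π) (by simp) i
      rw [h, Nat.add_mod_right, Nat.mod_eq_of_lt i.isLt] at h3
      exact hd i (Fin.ext h3.symm)
    have h4 := chord_fA hrep h1 h2
    have h5 : o n (fA (cv A) i.val) = π i := by
      rw [hf]
      apply Fin.ext
      show dec ∅ π i % n = _
      exact dec_mod (S := ∅) (π := π) (by simp) i
    rwa [h5] at h4
  refine exists_stable π (fun i => decide (i ∈ E₁)) ?_ ?_ ?_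
  · intro i
    simp only [decide_eq_decide]
    exact (s.colour_iff hrep (hchord i)).symm
  · obtain ⟨p, hp⟩ := s.ne1
    obtain ⟨q, hq⟩ := s.ne2
    rw [Finset.mem_compl] at hq
    exact ⟨p, q, by simp [hp, hq]⟩
  · intro i j hij
    simp only [ne_eq, decide_eq_decide] at hij
    by_cases hi : i ∈ E₁
    · have hj : j ∉ E₁ := fun h => hij ⟨fun _ => h, fun _ => hi⟩
      exact s.noncross hrep (hchord i) (hchord j) hi hj
    · have hj : j ∈ E₁ := by
        by_contra hj
        exact hij ⟨fun h => absurd h hi, fun h => absurd h hj⟩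
      exact s.symm.noncross hrep (hchord i) (hchord j) (Finset.mem_compl.2 hi)
        (fun h => (Finset.mem_compl.1 h) hj)
end
end Posi

open Finset
namespace Posi

theorem fac_bound (j m : ℕ) (hm : 3 ≤ m) :
    (j + 3).factorial * m.factorial ≤ 6 * (j + m).factorial := by
  induction j with
  | zero => simp [Nat.factorial]
  | succ j ih =>
    have h1 : (j + 1 + 3).factorial = (j + 4) * (j + 3).factorial := Nat.factorial_succ (j + 3)
    have h2 : (j + 1 + m).factorial = (j + m + 1) * (j + m).factorial := by
      rw [show j + 1 + m = j + m + 1 by ring, Nat.factorial_succ]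
    rw [h1, h2]
    calc (j + 4) * (j + 3).factorial * m.factorial
        = (j + 4) * ((j + 3).factorial * m.factorial) := by ring
      _ ≤ (j + m + 1) * (6 * (j + m).factorial) := Nat.mul_le_mul (by omega) ih
      _ = _ := by ring

theorem stable_iff {α : Type*} [DecidableEq α] (I : Finset α) (π : Equiv.Perm α)
    (h : ∀ w ∈ I, π w ∈ I) (x : α) : π x ∈ I ↔ x ∈ I := by
  refine ⟨fun hx => ?_, h x⟩
  have h1 : I.image π = I := by
    apply Finset.eq_of_subset_of_card_le
    · intro y hy
      obtain ⟨w, hw, rfl⟩ := Finset.mem_image.1 hy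
      exact h w hw
    · rw [Finset.card_image_of_injective _ π.injective]
  rw [← h1] at hx
  obtain ⟨w, hw, hwx⟩ := Finset.mem_image.1 hx
  rwa [← π.injective hwx]

theorem card_stable {n : ℕ} (I : Finset (Fin n)) :
    Nat.card {π : Equiv.Perm (Fin n) // ∀ w ∈ I, π w ∈ I} ≤
      I.card.factorial * (n - I.card).factorial := by
  have e1 : Nat.card (Equiv.Perm {x // x ∈ I}) = I.card.factorial := by
    rw [Nat.card_eq_fintype_card, Fintype.card_perm, Fintype.card_coe]
  have e2 : Nat.card (Equiv.Perm {x // x ∉ I}) = (n - I.card).factorial := by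
    rw [Nat.card_eq_fintype_card, Fintype.card_perm, Fintype.card_subtype_compl,
      Fintype.card_coe, Fintype.card_fin]
  rw [← e1, ← e2, ← Nat.card_prod]
  refine Nat.card_le_card_of_injective
    (fun π : {π : Equiv.Perm (Fin n) // ∀ w ∈ I, π w ∈ I} =>
      ((π.1.subtypePerm (p := fun x => x ∈ I) (stable_iff I π.1 π.2),
        π.1.subtypePerm (p := fun x => x ∉ I) (fun x => (stable_iff I π.1 π.2 x).not)) :
        Equiv.Perm {x // x ∈ I} × Equiv.Perm {x // x ∉ I})) ?_
  rintro ⟨π, hπ⟩ ⟨σ, hσ⟩ h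
  simp only [Prod.mk.injEq] at h
  apply Subtype.ext
  apply Equiv.ext
  intro x
  by_cases hx : x ∈ I
  · have := congrArg (fun f => (f ⟨x, hx⟩ : {x // x ∈ I}).1) h.1
    simpa using this
  · have := congrArg (fun f => (f ⟨x, hx⟩ : {x // x ∉ I}).1) h.2
    simpa using this

/-- derangements stabilising a given interval -/
def BadAt {n : ℕ} (a b : Fin n) (π : Equiv.Perm (Fin n)) : Prop :=
  (∀ i, π i ≠ i) ∧ a ≤ b ∧ Finset.Icc a b ≠ Finset.univ ∧
    ∀ w ∈ Finset.Icc a b, π w ∈ Finset.Icc a b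

theorem card_badAt {n : ℕ} (a b : Fin n) :
    Nat.card {π // BadAt a b π} ≤ 6 * (n - 3).factorial +
      (if b.val = a.val + 1 then 2 * (n - 2).factorial else 0) +
      (if b.val + 3 = a.val + n then 2 * (n - 2).factorial else 0) := by
  rcases isEmpty_or_nonempty {π // BadAt a b π} with he | ⟨⟨π, hd, hab, hne, hst⟩⟩
  · simp
  have hle : Nat.card {π // BadAt a b π} ≤
      (Finset.Icc a b).card.factorial * (n - (Finset.Icc a b).card).factorial := by
    refine le_trans ?_ (card_stable _)
    refine Nat.card_le_card_of_injective
      (fun π : {π // BadAt a b π} => (⟨π.1, π.2.2.2.2⟩ : {π : Equiv.Perm (Fin n) //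
        ∀ w ∈ Finset.Icc a b, π w ∈ Finset.Icc a b})) ?_
    intro p q h
    have h' := congrArg (fun t => t.1) h
    exact Subtype.ext h'
  have hk : (Finset.Icc a b).card = b.val + 1 - a.val := by simp
  have hab' : a.val ≤ b.val := hab
  have hb := b.isLt
  have k1 : (Finset.Icc a b).card ≠ 1 := by
    intro h
    obtain ⟨x, hx⟩ := Finset.card_eq_one.1 h
    rw [hx] at hst
    exact hd x (Finset.mem_singleton.1 (hst x (Finset.mem_singleton_self x)))
  have k2 : (Finset.Icc a b).card ≠ n := by
    intro h
    exact hne ((Finset.card_eq_iff_eq_univ _).1 (by rw [h, Fintype.card_fin]))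
  have k3 : (Finset.Icc a b).card + 1 ≠ n := by
    intro h
    have h1 : (Finset.Icc a b)ᶜ.card = 1 := by
      rw [Finset.card_compl, Fintype.card_fin]; omega
    obtain ⟨x, hx⟩ := Finset.card_eq_one.1 h1
    have h2 : x ∉ Finset.Icc a b := by
      rw [← Finset.mem_compl, hx]; exact Finset.mem_singleton_self x
    have h3 : π x ∉ Finset.Icc a b := (stable_iff _ π hst x).not.2 h2
    rw [← Finset.mem_compl, hx, Finset.mem_singleton] at h3
    exact hd x h3
  refine hle.trans ?_
  generalize (Finset.Icc a b).card = k at *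
  by_cases c1 : k = 2
  · subst c1
    rw [if_pos (by omega : b.val = a.val + 1)]
    simp only [Nat.factorial_two]
    omega
  by_cases c2 : k + 2 = n
  · subst c2
    rw [if_pos (by omega : b.val + 3 = a.val + (k + 2))]
    simp only [Nat.add_sub_cancel, Nat.add_sub_cancel_left, Nat.factorial_two]
    have := Nat.mul_comm k.factorial 2
    omega
  obtain ⟨j, rfl⟩ : ∃ j, k = j + 3 := ⟨k - 3, by omega⟩
  have h4 := fac_bound j (n - (j + 3)) (by omega)
  rw [show j + (n - (j + 3)) = n - 3 by omega] at h4
  omega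

/-- derangements stabilising some proper interval -/
def Bad {n : ℕ} (π : Equiv.Perm (Fin n)) : Prop :=
  (∀ i, π i ≠ i) ∧ ∃ a b : Fin n, a ≤ b ∧ Finset.Icc a b ≠ Finset.univ ∧
    ∀ w ∈ Finset.Icc a b, π w ∈ Finset.Icc a b

theorem card_bad (n : ℕ) : Nat.card {π : Equiv.Perm (Fin n) // Bad π} ≤
    n * (n * (6 * (n - 3).factorial) + 4 * (n - 2).factorial) := by
  classical
  have h1 : Nat.card {π : Equiv.Perm (Fin n) // Bad π} ≤
      Nat.card (Σ a : Fin n, Σ b : Fin n, {π // BadAt a b π}) := by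
    refine Nat.card_le_card_of_surjective
      (fun p : (Σ a : Fin n, Σ b : Fin n, {π // BadAt a b π}) =>
        (⟨p.2.2.1, p.2.2.2.1, p.1, p.2.1, p.2.2.2.2⟩ : {π : Equiv.Perm (Fin n) // Bad π})) ?_
    rintro ⟨π, hd, a, b, h⟩
    exact ⟨⟨a, b, π, hd, h⟩, rfl⟩
  refine h1.trans ?_
  rw [Nat.card_sigma]
  have h2 : ∀ a : Fin n, Nat.card (Σ b : Fin n, {π // BadAt a b π}) ≤
      n * (6 * (n - 3).factorial) + 4 * (n - 2).factorial := by
    intro a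
    rw [Nat.card_sigma]
    refine (Finset.sum_le_sum fun b _ => card_badAt a b).trans ?_
    rw [Finset.sum_add_distrib, Finset.sum_add_distrib, Finset.sum_const, Finset.card_univ,
      Fintype.card_fin, smul_eq_mul, ← Finset.sum_filter, ← Finset.sum_filter,
      Finset.sum_const, Finset.sum_const, smul_eq_mul, smul_eq_mul]
    have c1 : (Finset.univ.filter (fun b : Fin n => b.val = a.val + 1)).card ≤ 1 := by
      rw [Finset.card_le_one]
      intro x hx y hy
      simp only [Finset.mem_filter, Finset.mem_univ, true_and] at hx hy
      apply Fin.ext; omega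
    have c2 : (Finset.univ.filter (fun b : Fin n => b.val + 3 = a.val + n)).card ≤ 1 := by
      rw [Finset.card_le_one]
      intro x hx y hy
      simp only [Finset.mem_filter, Finset.mem_univ, true_and] at hx hy
      apply Fin.ext; omega
    have d1 := Nat.mul_le_mul_right (2 * (n - 2).factorial) c1
    have d2 := Nat.mul_le_mul_right (2 * (n - 2).factorial) c2
    omega
  refine (Finset.sum_le_sum fun a _ => h2 a).trans ?_
  rw [Finset.sum_const, Finset.card_univ, Fintype.card_fin, smul_eq_mul]

theorem card_bad_mul {n : ℕ} (hn : 4 ≤ n) :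
    Nat.card {π : Equiv.Perm (Fin n) // Bad π} * n ≤ 40 * n.factorial := by
  obtain ⟨m, rfl⟩ : ∃ m, n = m + 4 := ⟨n - 4, by omega⟩
  refine (Nat.mul_le_mul_right _ (card_bad (m + 4))).trans ?_
  rw [show m + 4 - 3 = m + 1 by omega, show m + 4 - 2 = m + 2 by omega]
  have e1 : (m + 4).factorial = (m + 4) * ((m + 3) * ((m + 2) * (m + 1).factorial)) := by
    rw [Nat.factorial_succ (m + 3), Nat.factorial_succ (m + 2), Nat.factorial_succ (m + 1)]
  rw [e1, Nat.factorial_succ (m + 1)]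
  generalize (m + 1).factorial = F
  have : (m + 4) * ((m + 4) * 6 + 4 * (m + 2)) ≤ 40 * ((m + 3) * (m + 2)) := by nlinarith
  have h2 := Nat.mul_le_mul_left ((m + 4) * F) this
  calc _ = (m + 4) * F * ((m + 4) * ((m + 4) * 6 + 4 * (m + 2))) := by ring
    _ ≤ _ := h2
    _ = _ := by ring

theorem conn_le {n : ℕ} [NeZero n] (hn : 2 ≤ n) : numConnPositroids n ≤ numDerangements n := by
  rw [← card_derangements_fin_eq_numDerangements, ← Nat.card_eq_fintype_card]
  unfold numConnPositroids
  have key : ∀ ℬ : {ℬ : Finset (Finset (Fin n)) //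
      IsPositroid (fun B => B ∈ ℬ) ∧ MatroidConnected (fun B => B ∈ ℬ)},
      ((posEquiv n).symm ⟨ℬ.1, ℬ.2.1⟩).1.1 = ∅ ∧
      ∀ i, ((posEquiv n).symm ⟨ℬ.1, ℬ.2.1⟩).1.2 i ≠ i := by
    rintro ⟨ℬ, hp, hc⟩
    have hr := posEquiv_rel ((posEquiv n).symm ⟨ℬ, hp⟩)
    rw [Equiv.apply_symm_apply] at hr
    generalize (posEquiv n).symm ⟨ℬ, hp⟩ = P at hr ⊢
    obtain ⟨⟨S, π⟩, hS⟩ := P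
    obtain ⟨d, A, hrep, hf⟩ := hr
    simp only at hS hf ⊢
    have hSe : S = ∅ := by
      rw [Finset.eq_empty_iff_forall_notMem]
      intro i hi
      exact not_loop_of_conn hn hrep hc i (by rw [hf, dec_eq_self]; exact hi)
    refine ⟨hSe, fun i hi => ?_⟩
    refine not_coloop_of_conn hn hrep hc i ?_
    rw [hf]
    simp [dec, hSe, hi]
  refine Nat.card_le_card_of_injective
    (fun ℬ : {ℬ : Finset (Finset (Fin n)) //
      IsPositroid (fun B => B ∈ ℬ) ∧ MatroidConnected (fun B => B ∈ ℬ)} =>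
      (⟨((posEquiv n).symm ⟨ℬ.1, ℬ.2.1⟩).1.2, (key ℬ).2⟩ : derangements (Fin n))) ?_
  intro ℬ 𝒞 h
  have h1 := congrArg Subtype.val h
  simp only at h1
  have h2 : (posEquiv n).symm ⟨ℬ.1, ℬ.2.1⟩ = (posEquiv n).symm ⟨𝒞.1, 𝒞.2.1⟩ := by
    apply Subtype.ext
    apply Prod.ext
    · rw [(key ℬ).1, (key 𝒞).1]
    · exact h1
  have h3 := congrArg Subtype.val ((posEquiv n).symm.injective h2)
  exact Subtype.ext h3

theorem le_conn {n : ℕ} [NeZero n] : numDerangements n ≤ numConnPositroids n +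
    Nat.card {π : Equiv.Perm (Fin n) // Bad π} := by
  classical
  rw [← card_derangements_fin_eq_numDerangements, ← Nat.card_eq_fintype_card]
  unfold numConnPositroids
  rw [← Nat.card_sum]
  have hpos : ∀ π : Equiv.Perm (Fin n), ∀ i ∈ ((∅ : Finset (Fin n)), π).1,
      ((∅ : Finset (Fin n)), π).2 i = i := by intro π i hi; simp at hi
  refine Nat.card_le_card_of_injective
    (fun π : derangements (Fin n) => if hb : Bad π.1 then Sum.inr ⟨π.1, hb⟩ else
      Sum.inl ⟨(posEquiv n ⟨(∅, π.1), hpos π.1⟩).1, (posEquiv n ⟨(∅, π.1), hpos π.1⟩).2, by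
        by_contra hc
        exact hb ⟨π.2, stable_of_not_conn π.2 (posEquiv_rel ⟨(∅, π.1), hpos π.1⟩) hc⟩⟩) ?_
  intro π σ h
  by_cases h1 : Bad π.1 <;> by_cases h2 : Bad σ.1
  · simp only [h1, h2, dif_pos, Sum.inr.injEq, Subtype.mk.injEq] at h
    exact Subtype.ext h
  · simp [h1, h2] at h
  · simp [h1, h2] at h
  · simp only [h1, h2, dite_false, Sum.inl.injEq, Subtype.mk.injEq] at h
    have h3 := (posEquiv n).injective (Subtype.ext h)
    have h4 := congrArg (fun p => p.1.2) h3
    exact Subtype.ext h4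

theorem tendsto_numConn : Filter.Tendsto (fun n => (numConnPositroids n : ℝ) / (n.factorial : ℝ))
    Filter.atTop (nhds (Real.exp (-1))) := by
  have hD := numDerangements_tendsto_inv_e
  have h40 : Filter.Tendsto (fun n : ℕ => (40 : ℝ) / (n : ℝ)) Filter.atTop (nhds 0) :=
    tendsto_const_div_atTop_nhds_zero_nat 40
  have hlow := hD.sub h40
  rw [sub_zero] at hlow
  refine tendsto_of_tendsto_of_tendsto_of_le_of_le' hlow hD ?_ ?_
  · filter_upwards [Filter.eventually_ge_atTop 4] with n hn
    haveI : NeZero n := ⟨by omega⟩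
    have h1 : (numDerangements n : ℝ) ≤ numConnPositroids n +
      (Nat.card {π : Equiv.Perm (Fin n) // Bad π} : ℝ) := by exact_mod_cast le_conn (n := n)
    have h2 : (Nat.card {π : Equiv.Perm (Fin n) // Bad π} : ℝ) * n ≤ 40 * n.factorial := by
      exact_mod_cast card_bad_mul hn
    have hF : (0 : ℝ) < n.factorial := by exact_mod_cast Nat.factorial_pos n
    have hn0 : (0 : ℝ) < n := by exact_mod_cast (by omega : 0 < n)
    have h3 : (Nat.card {π : Equiv.Perm (Fin n) // Bad π} : ℝ) / n.factorial ≤ 40 / n := by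
      rw [div_le_div_iff₀ hF hn0]; exact h2
    have h4 := div_le_div_of_nonneg_right h1 hF.le
    rw [add_div] at h4
    linarith
  · filter_upwards [Filter.eventually_ge_atTop 4] with n hn
    haveI : NeZero n := ⟨by omega⟩
    have h1 : (numConnPositroids n : ℝ) ≤ numDerangements n := by
      exact_mod_cast conn_le (n := n) (by omega)
    exact div_le_div_of_nonneg_right h1 (by positivity)

end Posi

/-- If `p(n)` is the number of positroids on `[n]` and
`p_c(n)` is the number of connected positroids on `[n]`, then
`p_c(n)/p(n) → 1/e²` as `n → ∞`. -/
theorem ratio_connected_positroids_tendsto :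
    Filter.Tendsto (fun n : ℕ => (numConnPositroids n : ℝ) / (numPositroids n : ℝ))
      Filter.atTop (nhds (1 / Real.exp 1 ^ 2)) := by
  have h := Posi.tendsto_numConn.div Posi.tendsto_numPositroids (Real.exp_ne_zero 1)
  have e : Real.exp (-1) / Real.exp 1 = 1 / Real.exp 1 ^ 2 := by
    rw [Real.exp_neg]
    field_simp
  rw [e] at h
  refine h.congr fun n => ?_
  have hF : (n.factorial : ℝ) ≠ 0 := by exact_mod_cast Nat.factorial_ne_zero n
  simp only [Pi.div_apply]
  exact div_div_div_cancel_right₀ hF _ _
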